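/- Given integers N ≥ 1 and a real number d > 1, there exists a constant B = B(N,d) > 1 with the following property: for every multicritical circle map f with irrational rotation number having at most N critical points, all of whose criticalities are at most d, there exists n₀ = n₀(f) ∈ ℕ such that for all n ≥ n₀ and any two adjacent atoms I and J of the n-th dynamical partition P_n (associated to a fixed critical point c₀ of f) one has |J|/B ≤ |I| ≤ B|J|. -/

import Mathlib

open Set Filter Topology
open scoped ENNReal

noncomputable section

namespace MCircle

/-- A lift of an orientation-preserving `C³` circle homeomorphism of `S¹ = ℝ/ℤ`:
a `C³`, strictly increasing map commuting with the unit translation. -/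
structure IsCircleMapLift (f : ℝ → ℝ) : Prop where
  smooth : ContDiff ℝ 3 f
  mono : StrictMono f
  periodic : ∀ x : ℝ, f (x + 1) = f x + 1

/-- `c` is a non-flat (power-law) critical point of `f` of criticality `d > 1`:
near `c` we have `f x = f c + φ x * |φ x| ^ (d - 1)` for a `C³` diffeomorphism `φ`
of a neighbourhood `W` of `c` with `φ c = 0`. -/
def IsNonFlatCritPt (f : ℝ → ℝ) (c d : ℝ) : Prop :=
  1 < d ∧ ∃ (W : Set ℝ) (φ : ℝ → ℝ), IsOpen W ∧ c ∈ W ∧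
    ContDiffOn ℝ 3 φ W ∧ φ c = 0 ∧ (∀ x ∈ W, deriv φ x ≠ 0) ∧ InjOn φ W ∧
    ∀ x ∈ W, f x = f c + φ x * |φ x| ^ (d - 1)

/-- `f` is (a lift of) a multicritical circle map: the set of critical points of the
induced circle map, represented in `[0,1)`, is the nonempty finite set `C`, and each
critical point `c ∈ C` is non-flat of criticality `dc c`. -/
def IsMulticriticalLift (f : ℝ → ℝ) (C : Finset ℝ) (dc : ℝ → ℝ) : Prop :=
  IsCircleMapLift f ∧ C.Nonempty ∧ (↑C : Set ℝ) ⊆ Ico (0 : ℝ) 1 ∧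
    (∀ x : ℝ, deriv f x = 0 ↔ ∃ c ∈ C, ∃ k : ℤ, x = c + (k : ℝ)) ∧
    ∀ c ∈ C, IsNonFlatCritPt f c (dc c)

/-- The lift `f` has (translation) rotation number `ρ`. -/
def HasRotNumber (f : ℝ → ℝ) (ρ : ℝ) : Prop :=
  Tendsto (fun n : ℕ => f^[n] 0 / (n : ℝ)) atTop (𝓝 ρ)

/-- `f` is (a lift of) a multicritical circle map with critical set `C` (criticalities
`dc`) and irrational rotation number `ρ`, the lift being normalized so that `ρ ∈ (0,1)`. -/
def GoodMap (f : ℝ → ℝ) (C : Finset ℝ) (dc : ℝ → ℝ) (ρ : ℝ) : Prop :=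
  IsMulticriticalLift f C dc ∧ HasRotNumber f ρ ∧ Irrational ρ ∧ ρ ∈ Ioo (0 : ℝ) 1

/-- The Gauss map. -/
def gaussMap (x : ℝ) : ℝ := Int.fract x⁻¹

/-- The partial quotients `aₙ` of the continued fraction expansion
`ρ = [a₀, a₁, …] = 1/(a₀ + 1/(a₁ + ⋯))`. -/
def cfA (ρ : ℝ) (n : ℕ) : ℕ := ⌊(gaussMap^[n] (Int.fract ρ))⁻¹⌋₊

/-- The denominators `qₙ` of the convergents of `ρ` (the return times):
`q₀ = 1`, `q₁ = a₀`, `q_{n+2} = a_{n+1} q_{n+1} + qₙ`. -/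
def qden (ρ : ℝ) : ℕ → ℕ
  | 0 => 1
  | 1 => cfA ρ 0
  | n + 2 => cfA ρ (n + 1) * qden ρ (n + 1) + qden ρ n

/-- The numerators `pₙ` of the convergents of `ρ`:
`p₀ = 0`, `p₁ = 1`, `p_{n+2} = a_{n+1} p_{n+1} + pₙ`. -/
def pnum (ρ : ℝ) : ℕ → ℕ
  | 0 => 0
  | 1 => 1
  | n + 2 => cfA ρ (n + 1) * pnum ρ (n + 1) + pnum ρ n

/-- The lift representative of the `n`-th closest return `f^{qₙ}(x)`,
normalized (by the integer `pₙ`) to lie at distance less than one from `x`. -/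
def retPt (f : ℝ → ℝ) (ρ x : ℝ) (n : ℕ) : ℝ := f^[qden ρ n] x - (pnum ρ n : ℝ)

/-- The arc `Iₙ(x)`, with endpoints `x` and `f^{qₙ}(x)` and containing `f^{q_{n+2}}(x)`,
realized as an interval in the lift. -/
def arcI (f : ℝ → ℝ) (ρ x : ℝ) (n : ℕ) : Set ℝ := uIcc x (retPt f ρ x n)

/-- The length `|Iₙ(x)|`. -/
def arcLen (f : ℝ → ℝ) (ρ x : ℝ) (n : ℕ) : ℝ := |retPt f ρ x n - x|

/-- The length `|f^j(Iₙ(x))|`. -/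
def arcImgLen (f : ℝ → ℝ) (ρ x : ℝ) (n j : ℕ) : ℝ :=
  |f^[j] (retPt f ρ x n) - f^[j] x|

/-- Indices for the atoms of the `n`-th dynamical partition
`𝒫ₙ(x) = {fⁱ(Iₙ(x)) : 0 ≤ i ≤ q_{n+1}-1} ∪ {f^j(I_{n+1}(x)) : 0 ≤ j ≤ qₙ-1}`. -/
abbrev AtomIdx (ρ : ℝ) (n : ℕ) : Type :=
  {i : ℕ // i < qden ρ (n + 1)} ⊕ {j : ℕ // j < qden ρ n}

/-- Left endpoint (in the lift) of an atom of `𝒫ₙ(x)`. -/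
def atomL (f : ℝ → ℝ) (ρ x : ℝ) (n : ℕ) : AtomIdx ρ n → ℝ
  | Sum.inl i => min (f^[i.1] x) (f^[i.1] (retPt f ρ x n))
  | Sum.inr j => min (f^[j.1] x) (f^[j.1] (retPt f ρ x (n + 1)))

/-- Right endpoint (in the lift) of an atom of `𝒫ₙ(x)`. -/
def atomR (f : ℝ → ℝ) (ρ x : ℝ) (n : ℕ) : AtomIdx ρ n → ℝ
  | Sum.inl i => max (f^[i.1] x) (f^[i.1] (retPt f ρ x n))
  | Sum.inr j => max (f^[j.1] x) (f^[j.1] (retPt f ρ x (n + 1)))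

/-- Length of an atom of `𝒫ₙ(x)`. -/
def atomLen (f : ℝ → ℝ) (ρ x : ℝ) (n : ℕ) (A : AtomIdx ρ n) : ℝ :=
  atomR f ρ x n A - atomL f ρ x n A

/-- Two lift points represent the same point of the circle `ℝ/ℤ`. -/
def SameCirclePt (a b : ℝ) : Prop := ∃ m : ℤ, a = b + (m : ℝ)

/-- Two atoms of `𝒫ₙ(x)` are adjacent: they are distinct and share an endpoint
on the circle. -/
def AdjacentAtoms (f : ℝ → ℝ) (ρ x : ℝ) (n : ℕ) (A B : AtomIdx ρ n) : Prop :=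
  A ≠ B ∧ ∃ p ∈ ({atomL f ρ x n A, atomR f ρ x n A} : Set ℝ),
    ∃ q ∈ ({atomL f ρ x n B, atomR f ρ x n B} : Set ℝ), SameCirclePt p q

/-- `A` is the left neighbour of `Δ` in `𝒫ₙ(x)`. -/
def IsLeftNbr (f : ℝ → ℝ) (ρ x : ℝ) (n : ℕ) (A Δ : AtomIdx ρ n) : Prop :=
  A ≠ Δ ∧ SameCirclePt (atomR f ρ x n A) (atomL f ρ x n Δ)

/-- `B` is the right neighbour of `Δ` in `𝒫ₙ(x)`. -/
def IsRightNbr (f : ℝ → ℝ) (ρ x : ℝ) (n : ℕ) (B Δ : AtomIdx ρ n) : Prop :=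
  B ≠ Δ ∧ SameCirclePt (atomL f ρ x n B) (atomR f ρ x n Δ)

/-- The arc `f^j(Δ)` is contained (as a circle arc) in some element of `𝒫ₙ(x)`. -/
def ImgInAtom (f : ℝ → ℝ) (ρ x : ℝ) (n j : ℕ) (Δ : AtomIdx ρ n) : Prop :=
  ∃ E : AtomIdx ρ n, ∃ m : ℤ,
    atomL f ρ x n E + (m : ℝ) ≤ f^[j] (atomL f ρ x n Δ) ∧
    f^[j] (atomR f ρ x n Δ) ≤ atomR f ρ x n E + (m : ℝ)

/-- An atom of `𝒫ₙ(x)` as a subset of the circle `ℝ/ℤ`. -/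
def atomSetC (f : ℝ → ℝ) (ρ x : ℝ) (n : ℕ) (A : AtomIdx ρ n) : Set (AddCircle (1 : ℝ)) :=
  (fun y : ℝ => (y : AddCircle (1 : ℝ))) '' Icc (atomL f ρ x n A) (atomR f ρ x n A)

/-- The interval `Tₙ = I_{n+1} ∪ Iₙ ∪ f^{qₙ}(Iₙ)`, realized in the lift. -/
def Tset (f : ℝ → ℝ) (ρ x : ℝ) (n : ℕ) : Set ℝ :=
  arcI f ρ x (n + 1) ∪ arcI f ρ x n ∪
    (fun z => f^[qden ρ n] z - (pnum ρ n : ℝ)) '' arcI f ρ x n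

/-- `j` is a critical time: `f^j(Tₙ)` contains a critical point of `f` (mod 1). -/
def IsCritTime (f : ℝ → ℝ) (ρ x : ℝ) (C : Finset ℝ) (n j : ℕ) : Prop :=
  ∃ c ∈ C, ∃ m : ℤ, c + (m : ℝ) ∈ f^[j] '' Tset f ρ x n

/-- The cross-ratio `[M,T] = |L||R|/(|L∪M||M∪R|)` of the configuration
`M = [b,c] ⋐ T = [a,d]` (so `L = [a,b]`, `R = [c,d]`). -/
def crossRatio (a b c d : ℝ) : ℝ := ((b - a) * (d - c)) / ((c - a) * (d - b))

/-- The cross-ratio distortion `CrD(g; M, T)` of `g` on the configuration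
`M = [b,c] ⋐ T = [a,d]`. -/
def crD (g : ℝ → ℝ) (a b c d : ℝ) : ℝ :=
  crossRatio (g a) (g b) (g c) (g d) / crossRatio a b c d

/-- The Schwarzian derivative `Sg = g'''/g' - (3/2)(g''/g')²`. -/
def schwarzian (g : ℝ → ℝ) (x : ℝ) : ℝ :=
  iteratedDeriv 3 g x / deriv g x - (3 / 2) * (iteratedDeriv 2 g x / deriv g x) ^ 2

/-- `g` is a diffeomorphism on `S` with distortion bounded by `K`. -/
def DiffeoWithDistortionLE (g : ℝ → ℝ) (S : Set ℝ) (K : ℝ) : Prop :=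
  ContDiffOn ℝ 1 g S ∧ InjOn g S ∧ (∀ x ∈ S, deriv g x ≠ 0) ∧
    ∀ x ∈ S, ∀ y ∈ S, |deriv g x| ≤ K * |deriv g y|

/-- `g` is a diffeomorphism on `S` with negative Schwarzian derivative. -/
def NegSchwarzDiffeoOn (g : ℝ → ℝ) (S : Set ℝ) : Prop :=
  ContDiffOn ℝ 3 g S ∧ InjOn g S ∧ ∀ x ∈ S, deriv g x ≠ 0 ∧ schwarzian g x < 0

/-- The local quasi-symmetric distortion
`σ_h(x) = lim_{δ→0} limsup_{|t|≤δ} |h(x+t)-h(x)|/|h(x)-h(x-t)|` of a circle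
homeomorphism lift `h`, with values in `[0,∞]`. -/
def qsDistortion (h : ℝ → ℝ) (x : ℝ) : ℝ≥0∞ :=
  Filter.limsup
    (fun t : ℝ => ENNReal.ofReal (|h (x + t) - h x| / |h x - h (x - t)|))
    (𝓝[≠] (0 : ℝ))

end MCircle

namespace MCircle

/-- The lift of a circle homeomorphism with irrational rotation number `ρ`, recorded through the
fact that `x ↦ f^k(x) - m` moves every point in the direction given by the sign of `k ρ - m`. -/
structure IrrationalLift (f : ℝ → ℝ) (ρ : ℝ) : Prop where
  cont : Continuous f
  mono : StrictMono f
  per : ∀ x : ℝ, f (x + 1) = f x + 1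
  irr : Irrational ρ
  lt_iter : ∀ (k : ℕ) (m : ℤ) (x : ℝ), (m : ℝ) < k * ρ → x + m < f^[k] x
  iter_lt : ∀ (k : ℕ) (m : ℤ) (x : ℝ), k * ρ < (m : ℝ) → f^[k] x < x + m

/-- The conjugate of `f` by `x ↦ -x`. -/
def reflect (f : ℝ → ℝ) (x : ℝ) : ℝ := -f (-x)

/-- The map `x ↦ f^q(x) - p`. -/
def retMap (f : ℝ → ℝ) (q : ℕ) (p : ℤ) (x : ℝ) : ℝ := f^[q] x - p

theorem reflect_iterate (f : ℝ → ℝ) (k : ℕ) (x : ℝ) : (reflect f)^[k] x = -f^[k] (-x) := by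
  induction k generalizing x with
  | zero => simp
  | succ k ih =>
    rw [Function.iterate_succ_apply, ih, Function.iterate_succ_apply]
    simp [reflect]

theorem retMap_reflect (f : ℝ → ℝ) (q : ℕ) (p : ℤ) (x : ℝ) :
    retMap (reflect f) q (-p) x = -retMap f q p (-x) := by
  simp only [retMap, reflect_iterate]
  push_cast
  ring

namespace IrrationalLift

theorem of_hasRotNumber {f : ℝ → ℝ} {ρ : ℝ} (hf : IsCircleMapLift f) (hr : HasRotNumber f ρ)
    (hirr : Irrational ρ) : IrrationalLift f ρ := by
  let F : CircleDeg1Lift := ⟨⟨f, hf.mono.monotone⟩, hf.periodic⟩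
  have hF : ∀ k : ℕ, ∀ x, (F ^ k) x = f^[k] x := fun k x => by
    rw [CircleDeg1Lift.coe_pow]; rfl
  have hτ : CircleDeg1Lift.translationNumber F = ρ :=
    CircleDeg1Lift.translationNumber_eq_of_tendsto₀ F hr
  refine ⟨hf.smooth.continuous, hf.mono, hf.periodic, hirr, ?_, ?_⟩
  · intro k m x h
    rw [← hF]
    apply CircleDeg1Lift.lt_map_of_int_lt_translationNumber
    rwa [CircleDeg1Lift.translationNumber_pow, hτ]
  · intro k m x h
    rw [← hF]
    apply CircleDeg1Lift.map_lt_of_translationNumber_lt_int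
    rwa [CircleDeg1Lift.translationNumber_pow, hτ]

variable {f : ℝ → ℝ} {ρ : ℝ}

protected theorem reflect (hf : IrrationalLift f ρ) : IrrationalLift (reflect f) (-ρ) where
  cont := (hf.cont.comp continuous_neg).neg
  mono := fun x y h => by
    have := hf.mono (neg_lt_neg h)
    simpa [MCircle.reflect] using this
  per := fun x => by
    have := hf.per (-x - 1)
    simp only [MCircle.reflect, neg_add]
    rw [sub_add_cancel] at this
    rw [← sub_eq_add_neg, this]; ring
  irr := hf.irr.neg
  lt_iter := fun k m x h => by
    have := hf.iter_lt k (-m) (-x) (by push_cast; linarith)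
    rw [reflect_iterate]; push_cast at this; linarith
  iter_lt := fun k m x h => by
    have := hf.lt_iter k (-m) (-x) (by push_cast; linarith)
    rw [reflect_iterate]; push_cast at this; linarith

theorem strictMono_iterate (hf : IrrationalLift f ρ) (k : ℕ) : StrictMono f^[k] :=
  hf.mono.iterate k

theorem map_add_int (hf : IrrationalLift f ρ) (m : ℤ) (x : ℝ) : f (x + m) = f x + m :=
  CircleDeg1Lift.map_add_int ⟨⟨f, hf.mono.monotone⟩, hf.per⟩ x m

theorem iterate_add_int (hf : IrrationalLift f ρ) (k : ℕ) (m : ℤ) (x : ℝ) :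
    f^[k] (x + m) = f^[k] x + m := by
  induction k generalizing x with
  | zero => simp
  | succ k ih => rw [Function.iterate_succ_apply, hf.map_add_int, ih, Function.iterate_succ_apply]

theorem iterate_sub_int (hf : IrrationalLift f ρ) (k : ℕ) (m : ℤ) (x : ℝ) :
    f^[k] (x - m) = f^[k] x - m := by
  have := hf.iterate_add_int k (-m) x
  push_cast at this
  simpa [sub_eq_add_neg] using this

theorem surjective (hf : IrrationalLift f ρ) : Function.Surjective f := by
  apply hf.cont.surjective
  · refine hf.mono.monotone.tendsto_atTop_atTop fun b => ?_
    refine ⟨0 + (⌈b - f 0⌉ : ℤ), ?_⟩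
    rw [hf.map_add_int]
    linarith [Int.le_ceil (b - f 0)]
  · refine hf.mono.monotone.tendsto_atBot_atBot fun b => ?_
    refine ⟨0 + (⌊b - f 0⌋ : ℤ), ?_⟩
    rw [hf.map_add_int]
    linarith [Int.floor_le (b - f 0)]

theorem retMap_strictMono (hf : IrrationalLift f ρ) (q : ℕ) (p : ℤ) :
    StrictMono (retMap f q p) := fun x y h => by
  simpa [retMap] using hf.strictMono_iterate q h

theorem retMap_continuous (hf : IrrationalLift f ρ) (q : ℕ) (p : ℤ) :
    Continuous (retMap f q p) := (hf.cont.iterate q).sub continuous_const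

theorem retMap_surjective (hf : IrrationalLift f ρ) (q : ℕ) (p : ℤ) :
    Function.Surjective (retMap f q p) := fun y => by
  obtain ⟨x, hx⟩ := hf.surjective.iterate q (y + p)
  exact ⟨x, by simp [retMap, hx]⟩

theorem retMap_add_int (hf : IrrationalLift f ρ) (q : ℕ) (p m : ℤ) (x : ℝ) :
    retMap f q p (x + m) = retMap f q p x + m := by
  simp only [retMap, hf.iterate_add_int]; ring

theorem iterate_retMap (hf : IrrationalLift f ρ) (k q : ℕ) (p : ℤ) (x : ℝ) :
    f^[k] (retMap f q p x) = retMap f q p (f^[k] x) := by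
  simp only [retMap, hf.iterate_sub_int, ← Function.iterate_add_apply, add_comm]

theorem retMap_retMap (hf : IrrationalLift f ρ) (a b : ℕ) (m p : ℤ) (x : ℝ) :
    retMap f a m (retMap f b p x) = retMap f (a + b) (m + p) x := by
  simp only [retMap, hf.iterate_sub_int, ← Function.iterate_add_apply]
  push_cast; ring

theorem retMap_comm (hf : IrrationalLift f ρ) (a b : ℕ) (m p : ℤ) (x : ℝ) :
    retMap f a m (retMap f b p x) = retMap f b p (retMap f a m x) := by
  rw [hf.retMap_retMap, hf.retMap_retMap, add_comm a, add_comm m]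

theorem retMap_lt_retMap (hf : IrrationalLift f ρ) {a b : ℕ} {m p : ℤ}
    (h : a * ρ - m < b * ρ - p) (x : ℝ) : retMap f a m x < retMap f b p x := by
  simp only [retMap]
  rcases le_total a b with hab | hab
  · obtain ⟨k, rfl⟩ := Nat.exists_eq_add_of_le hab
    have := hf.lt_iter k (p - m) (f^[a] x) (by push_cast at h ⊢; linarith)
    rw [add_comm a k, Function.iterate_add_apply]
    push_cast at this; linarith
  · obtain ⟨k, rfl⟩ := Nat.exists_eq_add_of_le hab
    have := hf.iter_lt k (m - p) (f^[b] x) (by push_cast at h ⊢; linarith)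
    rw [add_comm b k, Function.iterate_add_apply]
    push_cast at this; linarith

theorem retMap_le_retMap (hf : IrrationalLift f ρ) {a b : ℕ} {m p : ℤ}
    (h : a * ρ - m ≤ b * ρ - p) (x : ℝ) : retMap f a m x ≤ retMap f b p x := by
  rcases h.lt_or_eq with h | h
  · exact (hf.retMap_lt_retMap h x).le
  · have hab : a = b := by
      by_contra hne
      have hz : ((a : ℤ) - b : ℤ) ≠ 0 := by
        intro h0
        exact hne (by omega)
      have := (hf.irr.intCast_mul hz).ne_int (m - p)
      apply this
      push_cast; linarith
    subst hab
    have : m = p := by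
      have : (m : ℝ) = p := by linarith
      exact_mod_cast this
    rw [this]

theorem lt_retMap (hf : IrrationalLift f ρ) {b : ℕ} {p : ℤ} (h : 0 < b * ρ - p) (x : ℝ) :
    x < retMap f b p x := by
  simpa [retMap] using hf.retMap_lt_retMap (a := 0) (m := 0) (by simpa using h) x

theorem retMap_lt (hf : IrrationalLift f ρ) {b : ℕ} {p : ℤ} (h : b * ρ - p < 0) (x : ℝ) :
    retMap f b p x < x := by
  simpa [retMap] using hf.retMap_lt_retMap (b := 0) (p := 0) (by simpa using h) x

theorem retMap_le_add_one (hf : IrrationalLift f ρ) {b : ℕ} {p : ℤ} (h : b * ρ - p ≤ 1) (x : ℝ) :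
    retMap f b p x ≤ x + 1 := by
  simpa [retMap] using hf.retMap_le_retMap (b := 0) (p := -1) (by simpa using h) x

end IrrationalLift

/-- `(q, p)` and `(q', p')` behave like consecutive convergents of `ρ`, with `q ρ - p > 0`. -/
structure IsLevel (ρ : ℝ) (q : ℕ) (p : ℤ) (q' : ℕ) (p' : ℤ) : Prop where
  q_pos : 0 < q
  le : q ≤ q'
  pos : 0 < q * ρ - p
  le_one : q * ρ - p ≤ 1
  neg : q' * ρ - p' < 0
  lt : p' - q' * ρ < q * ρ - p
  best : ∀ k : ℕ, 0 < k → k < q' → ∀ m : ℤ, q * ρ - p ≤ |k * ρ - m|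

theorem IsLevel.of_det {ρ : ℝ} {q : ℕ} {p : ℤ} {q' : ℕ} {p' : ℤ} (hq : 0 < q) (hle : q ≤ q')
    (hpos : 0 < q * ρ - p) (h1 : q * ρ - p ≤ 1) (hneg : q' * ρ - p' < 0)
    (hlt : p' - q' * ρ < q * ρ - p) (hdet : ((q : ℤ) * p' - p * q') ^ 2 = 1) :
    IsLevel ρ q p q' p' := by
  refine ⟨hq, hle, hpos, h1, hneg, hlt, fun k hk hkq m => ?_⟩
  set D : ℤ := (q : ℤ) * p' - p * q' with hD
  obtain ⟨u, v, hku, hmu⟩ : ∃ u v : ℤ, (k : ℤ) = u * q + v * q' ∧ m = u * p + v * p' := by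
    refine ⟨D * (k * p' - m * q'), D * (q * m - p * k), ?_, ?_⟩
    · linear_combination (-(k : ℤ)) * hdet + D * k * hD
    · linear_combination (-m) * hdet + D * m * hD
  have hval : (k : ℝ) * ρ - m = u * (q * ρ - p) + v * (q' * ρ - p') := by
    have e1 : (k : ℝ) = u * q + v * q' := by exact_mod_cast hku
    have e2 : (m : ℝ) = u * p + v * p' := by exact_mod_cast hmu
    rw [e1, e2]; ring
  have hkz : (0 : ℤ) < k := by exact_mod_cast hk
  have hkqz : (k : ℤ) < q' := by exact_mod_cast hkq
  have hqz : (0 : ℤ) < q := by exact_mod_cast hq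
  have hq'z : (q : ℤ) ≤ q' := by exact_mod_cast hle
  rcases lt_trichotomy u 0 with hu | hu | hu
  · have hv : 1 ≤ v := by
      by_contra hv
      have hv : v ≤ 0 := by omega
      nlinarith [mul_nonneg (neg_nonneg.2 hv) (hqz.le.trans hq'z)]
    rw [le_abs]; right
    have hu' : (u : ℝ) ≤ -1 := by exact_mod_cast (by omega : u ≤ -1)
    have hv' : (1 : ℝ) ≤ v := by exact_mod_cast hv
    rw [hval]
    nlinarith [mul_nonneg (sub_nonneg.2 hu') hpos.le,
      mul_nonneg (sub_nonneg.2 hv') (neg_pos.2 hneg).le]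
  · subst hu
    rcases le_or_gt v 0 with hv | hv
    · nlinarith [mul_nonneg (neg_nonneg.2 hv) (hqz.le.trans hq'z)]
    · nlinarith [mul_nonneg (sub_nonneg.2 (show (1 : ℤ) ≤ v by omega)) (hqz.le.trans hq'z)]
  · have hv : v ≤ 0 := by
      by_contra hv
      have hv : 1 ≤ v := by omega
      nlinarith [mul_nonneg (sub_nonneg.2 hv) (hqz.le.trans hq'z)]
    rw [le_abs]; left
    have hu' : (1 : ℝ) ≤ u := by exact_mod_cast hu
    have hv' : (v : ℝ) ≤ 0 := by exact_mod_cast hv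
    rw [hval]
    nlinarith [mul_nonneg (sub_nonneg.2 hu') hpos.le,
      mul_nonneg (neg_nonneg.2 hv') (neg_pos.2 hneg).le]

section Convergents

variable {ρ : ℝ}

theorem gaussMap_irrational_mem {x : ℝ} (h : Irrational x) :
    Irrational (gaussMap x) ∧ gaussMap x ∈ Ioo (0 : ℝ) 1 := by
  have hi : Irrational (gaussMap x) := by
    exact h.inv.sub_intCast ⌊x⁻¹⌋
  refine ⟨hi, lt_of_le_of_ne (Int.fract_nonneg _) (Ne.symm hi.ne_zero), Int.fract_lt_one _⟩

theorem gaussMap_iterate_mem (h : Irrational ρ) (hρ : ρ ∈ Ioo (0 : ℝ) 1) (n : ℕ) :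
    Irrational (gaussMap^[n] ρ) ∧ gaussMap^[n] ρ ∈ Ioo (0 : ℝ) 1 := by
  induction n with
  | zero => exact ⟨h, hρ⟩
  | succ n ih =>
    rw [Function.iterate_succ_apply']
    exact gaussMap_irrational_mem ih.1

theorem cfA_add_gaussMap (h : Irrational ρ) (hρ : ρ ∈ Ioo (0 : ℝ) 1) (n : ℕ) :
    (cfA ρ n : ℝ) + gaussMap^[n + 1] ρ = (gaussMap^[n] ρ)⁻¹ := by
  have hfr : Int.fract ρ = ρ := Int.fract_eq_self.2 ⟨hρ.1.le, hρ.2⟩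
  have hx := (gaussMap_iterate_mem h hρ n).2
  rw [cfA, hfr, Function.iterate_succ_apply', gaussMap]
  rw [natCast_floor_eq_intCast_floor (inv_nonneg.2 hx.1.le)]
  exact Int.floor_add_fract _

theorem one_le_cfA (h : Irrational ρ) (hρ : ρ ∈ Ioo (0 : ℝ) 1) (n : ℕ) : 1 ≤ cfA ρ n := by
  have hfr : Int.fract ρ = ρ := Int.fract_eq_self.2 ⟨hρ.1.le, hρ.2⟩
  have hx := (gaussMap_iterate_mem h hρ n).2
  rw [cfA, hfr]
  apply Nat.le_floor
  rw [Nat.cast_one]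
  exact (one_lt_inv₀ hx.1).2 hx.2 |>.le

theorem qden_pos (h : Irrational ρ) (hρ : ρ ∈ Ioo (0 : ℝ) 1) (n : ℕ) :
    0 < qden ρ n ∧ 0 < qden ρ (n + 1) := by
  induction n with
  | zero => exact ⟨Nat.one_pos, one_le_cfA h hρ 0⟩
  | succ n ih => exact ⟨ih.2, Nat.add_pos_right _ ih.1⟩

theorem qden_le (h : Irrational ρ) (hρ : ρ ∈ Ioo (0 : ℝ) 1) (n : ℕ) :
    qden ρ n ≤ qden ρ (n + 1) := by
  cases n with
  | zero => exact one_le_cfA h hρ 0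
  | succ n =>
    show _ ≤ cfA ρ (n + 1) * qden ρ (n + 1) + qden ρ n
    have := Nat.mul_le_mul_right (qden ρ (n + 1)) (one_le_cfA h hρ (n + 1))
    omega

theorem qden_pnum_det (n : ℕ) :
    ((qden ρ n : ℤ) * pnum ρ (n + 1) - pnum ρ n * qden ρ (n + 1)) ^ 2 = 1 := by
  induction n with
  | zero => simp [qden, pnum]
  | succ n ih =>
    rw [← ih]
    simp only [qden, pnum]
    push_cast; ring

theorem convergent_error_succ (h : Irrational ρ) (hρ : ρ ∈ Ioo (0 : ℝ) 1) (n : ℕ) :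
    qden ρ (n + 1) * ρ - pnum ρ (n + 1) = -gaussMap^[n + 1] ρ * (qden ρ n * ρ - pnum ρ n) := by
  induction n with
  | zero =>
    have := cfA_add_gaussMap h hρ 0
    have h0 := hρ.1.ne'
    simp only [Function.iterate_zero, id] at this
    simp only [qden, pnum]
    have e : gaussMap^[0 + 1] ρ = ρ⁻¹ - cfA ρ 0 := by linarith
    rw [e]; field_simp; push_cast; ring
  | succ n ih =>
    have h1 := cfA_add_gaussMap h hρ (n + 1)
    have h0 := (gaussMap_iterate_mem h hρ (n + 1)).2.1.ne'
    set y := gaussMap^[n + 1] ρ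
    have e : gaussMap^[n + 1 + 1] ρ = y⁻¹ - cfA ρ (n + 1) := by linarith
    have e2 : (qden ρ n * ρ - pnum ρ n : ℝ) = -y⁻¹ * (qden ρ (n + 1) * ρ - pnum ρ (n + 1)) := by
      rw [ih]; field_simp
    have e3 : (qden ρ (n + 1 + 1) * ρ - pnum ρ (n + 1 + 1) : ℝ) =
        cfA ρ (n + 1) * (qden ρ (n + 1) * ρ - pnum ρ (n + 1)) + (qden ρ n * ρ - pnum ρ n) := by
      simp only [qden, pnum]; push_cast; ring
    rw [e3, e, e2]; ring

theorem convergent_error_pos (h : Irrational ρ) (hρ : ρ ∈ Ioo (0 : ℝ) 1) (n : ℕ) :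
    0 < (-1) ^ n * (qden ρ n * ρ - pnum ρ n) ∧ (-1) ^ n * (qden ρ n * ρ - pnum ρ n) < 1 := by
  induction n with
  | zero => simpa [qden, pnum] using hρ
  | succ n ih =>
    have hx := (gaussMap_iterate_mem h hρ (n + 1)).2
    rw [convergent_error_succ h hρ n]
    have : (-1) ^ (n + 1) * (-gaussMap^[n + 1] ρ * (qden ρ n * ρ - pnum ρ n)) =
      gaussMap^[n + 1] ρ * ((-1) ^ n * (qden ρ n * ρ - pnum ρ n)) := by ring
    rw [this]
    refine ⟨mul_pos hx.1 ih.1, by nlinarith [hx.1, hx.2, ih.1, ih.2]⟩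

theorem convergent_error_lt (h : Irrational ρ) (hρ : ρ ∈ Ioo (0 : ℝ) 1) (n : ℕ) :
    (-1) ^ (n + 1) * (qden ρ (n + 1) * ρ - pnum ρ (n + 1)) <
      (-1) ^ n * (qden ρ n * ρ - pnum ρ n) := by
  have hx := (gaussMap_iterate_mem h hρ (n + 1)).2
  have hp := (convergent_error_pos h hρ n).1
  rw [convergent_error_succ h hρ n]
  have : (-1) ^ (n + 1) * (-gaussMap^[n + 1] ρ * (qden ρ n * ρ - pnum ρ n)) =
      gaussMap^[n + 1] ρ * ((-1) ^ n * (qden ρ n * ρ - pnum ρ n)) := by ring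
  rw [this]
  nlinarith [hx.1, hx.2]

theorem convergent_error_recurrence (h : Irrational ρ) (hρ : ρ ∈ Ioo (0 : ℝ) 1) (n : ℕ) :
    (-1) ^ (n + 2) * (qden ρ (n + 2) * ρ - pnum ρ (n + 2)) ≤
      (-1) ^ n * (qden ρ n * ρ - pnum ρ n) -
        (-1) ^ (n + 1) * (qden ρ (n + 1) * ρ - pnum ρ (n + 1)) := by
  have hp := (convergent_error_pos h hρ (n + 1)).1
  have e3 : (qden ρ (n + 2) * ρ - pnum ρ (n + 2) : ℝ) =
        cfA ρ (n + 1) * (qden ρ (n + 1) * ρ - pnum ρ (n + 1)) + (qden ρ n * ρ - pnum ρ n) := by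
      simp only [qden, pnum]; push_cast; ring
  rw [e3]
  have ha : (1 : ℝ) ≤ cfA ρ (n + 1) := by exact_mod_cast one_le_cfA h hρ (n + 1)
  have e : (-1 : ℝ) ^ (n + 2) * (cfA ρ (n + 1) * (qden ρ (n + 1) * ρ - pnum ρ (n + 1)) +
      (qden ρ n * ρ - pnum ρ n)) = (-1) ^ n * (qden ρ n * ρ - pnum ρ n) -
        cfA ρ (n + 1) * ((-1) ^ (n + 1) * (qden ρ (n + 1) * ρ - pnum ρ (n + 1))) := by ring
  rw [e]
  nlinarith

theorem isLevel_of_even (h : Irrational ρ) (hρ : ρ ∈ Ioo (0 : ℝ) 1) {n : ℕ} (hn : Even n) :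
    IsLevel ρ (qden ρ n) (pnum ρ n : ℤ) (qden ρ (n + 1)) (pnum ρ (n + 1) : ℤ) := by
  have h1 := convergent_error_pos h hρ n
  have h2 := convergent_error_pos h hρ (n + 1)
  have h3 := convergent_error_lt h hρ n
  rw [pow_succ] at h2 h3
  rw [hn.neg_one_pow] at h1 h2 h3
  refine IsLevel.of_det (qden_pos h hρ n).1 (qden_le h hρ n) ?_ ?_ ?_ ?_ (qden_pnum_det n)
  all_goals push_cast; linarith

theorem isLevel_of_odd (h : Irrational ρ) (hρ : ρ ∈ Ioo (0 : ℝ) 1) {n : ℕ} (hn : Odd n) :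
    IsLevel (-ρ) (qden ρ n) (-(pnum ρ n : ℤ)) (qden ρ (n + 1)) (-(pnum ρ (n + 1) : ℤ)) := by
  have h1 := convergent_error_pos h hρ n
  have h2 := convergent_error_pos h hρ (n + 1)
  have h3 := convergent_error_lt h hρ n
  rw [pow_succ] at h2 h3
  rw [hn.neg_one_pow] at h1 h2 h3
  refine IsLevel.of_det (qden_pos h hρ n).1 (qden_le h hρ n) ?_ ?_ ?_ ?_ ?_
  on_goal 5 => rw [← qden_pnum_det (ρ := ρ) n]; ring
  all_goals push_cast; linarith

end Convergents

section CrossRatio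

variable {a b c e : ℝ}

theorem crossRatio_pos (hab : a < b) (hbc : b < c) (hce : c < e) : 0 < crossRatio a b c e := by
  unfold crossRatio
  have h1 : 0 < b - a := by linarith
  have h2 : 0 < e - c := by linarith
  have h3 : 0 < c - a := by linarith
  have h4 : 0 < e - b := by linarith
  positivity

theorem crossRatio_le_left (hab : a < b) (hbc : b < c) (hce : c < e) :
    crossRatio a b c e ≤ (b - a) / (c - a) := by
  unfold crossRatio
  have h1 : 0 < b - a := by linarith
  have h3 : 0 < c - a := by linarith
  have h4 : 0 < e - b := by linarith
  rw [div_le_div_iff₀ (by positivity) h3]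
  have : (b - a) * (c - a) * (e - c) ≤ (b - a) * (c - a) * (e - b) :=
    mul_le_mul_of_nonneg_left (by linarith) (by positivity)
  linarith

theorem crossRatio_neg : crossRatio (-e) (-c) (-b) (-a) = crossRatio a b c e := by
  unfold crossRatio; congr 1 <;> ring

theorem crossRatio_sub (m : ℝ) :
    crossRatio (a - m) (b - m) (c - m) (e - m) = crossRatio a b c e := by
  unfold crossRatio; congr 1 <;> ring

theorem mul_le_left_of_le_crossRatio {t : ℝ} (ht : 0 ≤ t) (hab : a < b) (hbc : b < c) (hce : c < e)
    (h : t ≤ crossRatio a b c e) : t * (c - b) ≤ b - a := by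
  have := h.trans (crossRatio_le_left hab hbc hce)
  rw [le_div_iff₀ (by linarith)] at this
  nlinarith

theorem mul_le_right_of_le_crossRatio {t : ℝ} (ht : 0 ≤ t) (hab : a < b) (hbc : b < c)
    (hce : c < e) (h : t ≤ crossRatio a b c e) : t * (c - b) ≤ e - c := by
  rw [← crossRatio_neg] at h
  have := mul_le_left_of_le_crossRatio ht (by linarith) (by linarith) (by linarith) h
  linarith

theorem inv_sq_le_crossRatio {E : ℝ} (hE : 0 ≤ E) (hab : a < b) (hbc : b < c) (hce : c < e)
    (h1 : c - b ≤ E * (b - a)) (h2 : c - b ≤ E * (e - c)) :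
    ((1 + E) ^ 2)⁻¹ ≤ crossRatio a b c e := by
  unfold crossRatio
  have h3 : 0 < c - a := by linarith
  have h4 : 0 < e - b := by linarith
  rw [inv_eq_one_div, div_le_div_iff₀ (by positivity) (by positivity)]
  have e1 : c - a ≤ (1 + E) * (b - a) := by linarith
  have e2 : e - b ≤ (1 + E) * (e - c) := by linarith
  have := mul_le_mul e1 e2 h4.le (by nlinarith)
  nlinarith

end CrossRatio

/-- `f` increases the cross-ratio of configurations of length at most `δ` by at most the factor
`exp (κ |T|)`, times `exp Λ` if the interior of `T` meets `C + ℤ`. -/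
def LocalCrossRatioBound (f : ℝ → ℝ) (C : Finset ℝ) (κ δ Λ : ℝ) : Prop :=
  open Classical in
  ∀ a b c e : ℝ, a < b → b < c → c < e → e - a ≤ δ →
    crossRatio (f a) (f b) (f c) (f e) ≤
      Real.exp (κ * (e - a) + if ∃ s ∈ C, ∃ m : ℤ, a < s + m ∧ s + m < e then Λ else 0) *
        crossRatio a b c e

/-- The first `3 q'` iterates of `f` increase cross-ratios of configurations contained in three
consecutive fundamental domains of `x ↦ f^q(x) - p` by at most the factor `B`. -/
def WindowCrossRatioBound (f : ℝ → ℝ) (q : ℕ) (p : ℤ) (q' : ℕ) (B : ℝ) : Prop :=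
  ∀ x a b c e : ℝ, x ≤ a → a < b → b < c → c < e →
    e ≤ retMap f q p (retMap f q p (retMap f q p x)) → ∀ k ≤ 3 * q',
      crossRatio (f^[k] a) (f^[k] b) (f^[k] c) (f^[k] e) ≤ B * crossRatio a b c e

section Window

variable {f : ℝ → ℝ} {ρ : ℝ} {q q' : ℕ} {p p' : ℤ}

theorem IsLevel.disjoint_iterates (hf : IrrationalLift f ρ) (hL : IsLevel ρ q p q' p') {i j : ℕ}
    (hij : i < j) (hj : j < q') (m : ℤ) (y : ℝ) :
    retMap f q p (f^[i] y) ≤ f^[j] y + m ∨ retMap f q p (f^[j] y) + m ≤ f^[i] y := by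
  obtain ⟨k, rfl⟩ := Nat.exists_eq_add_of_le hij.le
  have hb := hL.best k (by omega) (by omega) (-m)
  rw [add_comm i k, Function.iterate_add_apply]
  set u := f^[i] y
  rcases le_abs.1 hb with hb | hb
  · left
    have := hf.retMap_le_retMap hb u
    simpa [retMap] using this
  · right
    have := hf.retMap_le_retMap (a := q + k) (m := p - m) (b := 0) (p := 0)
      (by push_cast at hb ⊢; linarith) u
    simp only [retMap, Function.iterate_add_apply, Function.iterate_zero, id] at this ⊢
    push_cast at this; linarith

theorem IsLevel.sum_gap_le (hf : IrrationalLift f ρ) (hL : IsLevel ρ q p q' p') (y : ℝ) :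
    ∑ i ∈ Finset.range q', (retMap f q p (f^[i] y) - f^[i] y) ≤ 2 := by
  set I : ℕ → Set ℝ := fun i =>
    Ico (f^[i] y - ⌊f^[i] y⌋) (retMap f q p (f^[i] y) - ⌊f^[i] y⌋) with hI
  have hdisj : ∀ i j : ℕ, i < j → j < q' → Disjoint (I i) (I j) := by
    intro i j hij hj
    rw [Set.disjoint_left]
    rintro t ⟨h1, h2⟩ ⟨h3, h4⟩
    rcases hL.disjoint_iterates hf hij hj (⌊f^[i] y⌋ - ⌊f^[j] y⌋) y with h | h
    · push_cast at h; linarith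
    · push_cast at h; linarith
  have hpd : Set.PairwiseDisjoint (↑(Finset.range q')) I := by
    intro i hi j hj hij
    simp only [Finset.coe_range, mem_Iio] at hi hj
    rcases lt_or_gt_of_ne hij with h | h
    · exact hdisj i j h hj
    · exact (hdisj j i h hi).symm
  have hm := MeasureTheory.measure_biUnion_finset (μ := MeasureTheory.volume) hpd
    (fun i _ => measurableSet_Ico)
  have hsub : (⋃ i ∈ Finset.range q', I i) ⊆ Icc (0 : ℝ) 2 := by
    refine iUnion₂_subset fun i _ t ht => ?_
    have h1 := Int.floor_le (f^[i] y)
    have h2 := Int.lt_floor_add_one (f^[i] y)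
    have h3 := hf.retMap_le_add_one hL.le_one (f^[i] y)
    exact ⟨by linarith [ht.1], by linarith [ht.2]⟩
  have hle := MeasureTheory.measure_mono (μ := MeasureTheory.volume) hsub
  rw [hm] at hle
  simp only [hI, Real.volume_Ico, Real.volume_Icc, sub_sub_sub_cancel_right, sub_zero] at hle
  rw [← ENNReal.ofReal_sum_of_nonneg] at hle
  · exact (ENNReal.ofReal_le_ofReal_iff (by norm_num)).1 hle
  · intro i _
    exact sub_nonneg.2 (hf.lt_retMap hL.pos _).le

open Classical in
theorem IsLevel.sum_card_le (hf : IrrationalLift f ρ) (hL : IsLevel ρ q p q' p') (C : Finset ℝ)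
    (y : ℝ) :
    ∑ i ∈ Finset.range q',
      {s ∈ C | ∃ m : ℤ, f^[i] y ≤ s + m ∧ s + m < retMap f q p (f^[i] y)}.card ≤ C.card := by
  simp_rw [Finset.card_filter]
  rw [Finset.sum_comm, Finset.card_eq_sum_ones]
  refine Finset.sum_le_sum fun s _ => ?_
  rw [← Finset.card_filter, Finset.card_le_one]
  have key : ∀ i j : ℕ, i < j → j < q' →
      (∃ m : ℤ, f^[i] y ≤ s + m ∧ s + m < retMap f q p (f^[i] y)) →
      (∃ m : ℤ, f^[j] y ≤ s + m ∧ s + m < retMap f q p (f^[j] y)) → False := by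
    rintro i j hij hj ⟨m, h1, h2⟩ ⟨m', h3, h4⟩
    rcases hL.disjoint_iterates hf hij hj (m - m') y with h | h
    · push_cast at h; linarith
    · push_cast at h; linarith
  intro i hi j hj
  simp only [Finset.mem_filter, Finset.mem_range] at hi hj
  rcases lt_trichotomy i j with h | h | h
  · exact (key i j h hj.1 hi.2 hj.2).elim
  · exact h
  · exact (key j i h hi.1 hj.2 hi.2).elim

open Classical in
theorem LocalCrossRatioBound.window (hf : IrrationalLift f ρ) (hL : IsLevel ρ q p q' p')
    {C : Finset ℝ} {κ δ Λ : ℝ} (hκ : 0 ≤ κ) (hΛ : 0 ≤ Λ) (hC : LocalCrossRatioBound f C κ δ Λ)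
    (hδ : ∀ x, retMap f q p (retMap f q p (retMap f q p x)) - x ≤ δ) :
    WindowCrossRatioBound f q p q' (Real.exp (9 * (2 * κ + C.card * Λ))) := by
  set g := retMap f q p with hg
  have hgx : ∀ x, x < g x := hf.lt_retMap hL.pos
  have hfg : ∀ k x, f^[k] (g x) = g (f^[k] x) := fun k x => hf.iterate_retMap k q p x
  set w : ℝ → ℝ := fun y => κ * (g y - y) +
    ({s ∈ C | ∃ m : ℤ, y ≤ s + m ∧ s + m < g y}.card : ℝ) * Λ with hw
  have hw0 : ∀ y, 0 ≤ w y := fun y =>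
    add_nonneg (mul_nonneg hκ (sub_nonneg.2 (hgx y).le)) (mul_nonneg (Nat.cast_nonneg _) hΛ)
  have hblock : ∀ y, ∑ i ∈ Finset.range q', w (f^[i] y) ≤ 2 * κ + C.card * Λ := by
    intro y
    rw [hw]
    simp only
    rw [Finset.sum_add_distrib, ← Finset.mul_sum, ← Finset.sum_mul, ← Nat.cast_sum]
    have h1 := hL.sum_gap_le hf y
    have h2 := hL.sum_card_le hf C y
    have h2' := (Nat.cast_le (α := ℝ)).2 h2
    have := mul_le_mul_of_nonneg_left h1 hκ
    have := mul_le_mul_of_nonneg_right h2' hΛ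
    linarith
  have hblock3 : ∀ y, ∑ i ∈ Finset.range (3 * q'), w (f^[i] y) ≤ 3 * (2 * κ + C.card * Λ) := by
    intro y
    rw [show 3 * q' = q' + q' + q' by ring, Finset.sum_range_add, Finset.sum_range_add]
    have h1 := hblock y
    have h2 := hblock (f^[q'] y)
    have h3 := hblock (f^[q' + q'] y)
    simp only [← Function.iterate_add_apply] at h2 h3
    simp only [add_comm _ q', add_comm _ (q' + q')] at h2 h3
    linarith
  have hstep : ∀ x a b c e : ℝ, x ≤ a → a < b → b < c → c < e → e ≤ g (g (g x)) →
      crossRatio (f a) (f b) (f c) (f e) ≤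
        Real.exp (w x + w (g x) + w (g (g x))) * crossRatio a b c e := by
    intro x a b c e hxa hab hbc hce heg
    refine (hC a b c e hab hbc hce (by linarith [hδ x])).trans ?_
    refine mul_le_mul_of_nonneg_right (Real.exp_le_exp.2 ?_) (crossRatio_pos hab hbc hce).le
    have hlen : κ * (e - a) ≤ κ * (g x - x) + κ * (g (g x) - g x) +
        κ * (g (g (g x)) - g (g x)) := by
      rw [← mul_add, ← mul_add]
      exact mul_le_mul_of_nonneg_left (by linarith) hκ
    have hn : ∀ y : ℝ, 0 ≤ ({s ∈ C | ∃ m : ℤ, y ≤ s + m ∧ s + m < g y}.card : ℝ) * Λ :=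
      fun y => mul_nonneg (Nat.cast_nonneg _) hΛ
    have hcrit : (if ∃ s ∈ C, ∃ m : ℤ, a < s + m ∧ s + m < e then Λ else 0) ≤
        ({s ∈ C | ∃ m : ℤ, x ≤ s + m ∧ s + m < g x}.card : ℝ) * Λ +
        ({s ∈ C | ∃ m : ℤ, g x ≤ s + m ∧ s + m < g (g x)}.card : ℝ) * Λ +
        ({s ∈ C | ∃ m : ℤ, g (g x) ≤ s + m ∧ s + m < g (g (g x))}.card : ℝ) * Λ := by
      split_ifs with h
      · obtain ⟨s, hs, m, h1, h2⟩ := h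
        have key : ∀ y : ℝ, y ≤ s + m → s + m < g y →
            Λ ≤ ({s ∈ C | ∃ m : ℤ, y ≤ s + m ∧ s + m < g y}.card : ℝ) * Λ := by
          intro y hy1 hy2
          refine le_mul_of_one_le_left hΛ ?_
          rw [Nat.one_le_cast, Nat.one_le_iff_ne_zero, ← Nat.pos_iff_ne_zero, Finset.card_pos]
          exact ⟨s, Finset.mem_filter.2 ⟨hs, m, hy1, hy2⟩⟩
        rcases lt_or_ge (s + m) (g x) with h3 | h3
        · linarith [key x (by linarith) h3, hn (g x), hn (g (g x))]
        · rcases lt_or_ge (s + m) (g (g x)) with h4 | h4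
          · linarith [key (g x) h3 h4, hn x, hn (g (g x))]
          · linarith [key (g (g x)) h4 (by linarith), hn x, hn (g x)]
      · linarith [hn x, hn (g x), hn (g (g x))]
    simp only [hw]
    linarith
  intro x a b c e hxa hab hbc hce heg k hk
  have hiter : ∀ k, crossRatio (f^[k] a) (f^[k] b) (f^[k] c) (f^[k] e) ≤
      Real.exp (∑ i ∈ Finset.range k, (w (f^[i] x) + w (f^[i] (g x)) + w (f^[i] (g (g x))))) *
        crossRatio a b c e := by
    intro k
    induction k with
    | zero => simp
    | succ k ih =>
      have hm := hf.strictMono_iterate k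
      have := hstep (f^[k] x) (f^[k] a) (f^[k] b) (f^[k] c) (f^[k] e) (hm.monotone hxa) (hm hab)
        (hm hbc) (hm hce) (by
          have := hm.monotone heg
          rw [← hg] at this
          simpa only [hfg] using this)
      simp only [Function.iterate_succ_apply']
      refine this.trans ?_
      rw [Finset.sum_range_succ, add_comm (Finset.sum _ _), Real.exp_add _ (Finset.sum _ _),
        mul_assoc, hfg, hfg, hfg]
      exact mul_le_mul_of_nonneg_left ih (Real.exp_pos _).le
  refine (hiter k).trans (mul_le_mul_of_nonneg_right (Real.exp_le_exp.2 ?_)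
    (crossRatio_pos hab hbc hce).le)
  calc _ ≤ ∑ i ∈ Finset.range (3 * q'),
        (w (f^[i] x) + w (f^[i] (g x)) + w (f^[i] (g (g x)))) :=
        Finset.sum_le_sum_of_subset_of_nonneg (Finset.range_subset_range.2 hk) fun i _ _ =>
          add_nonneg (add_nonneg (hw0 _) (hw0 _)) (hw0 _)
    _ ≤ _ := by
        rw [Finset.sum_add_distrib, Finset.sum_add_distrib]
        linarith [hblock3 x, hblock3 (g x), hblock3 (g (g x))]

end Window

section Level

variable {f : ℝ → ℝ} {ρ : ℝ} {q q' : ℕ} {p p' : ℤ}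

/-- Every orbit segment of length `q + q'` visits each fundamental domain of `x ↦ f^q(x) - p`. -/
theorem IsLevel.exists_iterate_mem (hf : IrrationalLift f ρ) (hL : IsLevel ρ q p q' p')
    (x z : ℝ) : ∃ k < q + q', ∃ m : ℤ, z ≤ f^[k] x + m ∧ f^[k] x + m ≤ retMap f q p z := by
  set g := retMap f q p with hg
  have hne : (Finset.range (q + q')).Nonempty := by
    rw [Finset.nonempty_range_iff]; have := hL.q_pos; omega
  obtain ⟨k, hk, hmax⟩ := Finset.exists_max_image (Finset.range (q + q'))
    (fun k => f^[k] x + (⌊g z - f^[k] x⌋ : ℤ)) hne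
  rw [Finset.mem_range] at hk
  set m : ℤ := ⌊g z - f^[k] x⌋ with hm
  have hle : f^[k] x + m ≤ g z := by linarith [Int.floor_le (g z - f^[k] x)]
  refine ⟨k, hk, m, ?_, hle⟩
  by_contra! hlt
  have hbig : ∀ k' < q + q', ∀ m' : ℤ, f^[k'] x + m' ≤ g z → f^[k'] x + m' ≤ f^[k] x + m := by
    intro k' hk' m' h
    refine le_trans ?_ (hmax k' (Finset.mem_range.2 hk'))
    have : m' ≤ ⌊g z - f^[k'] x⌋ := Int.le_floor.2 (by linarith)
    have : (m' : ℝ) ≤ (⌊g z - f^[k'] x⌋ : ℤ) := by exact_mod_cast this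
    linarith
  have hgk : g (f^[k] x + m) = f^[q + k] x + ((m - p : ℤ) : ℝ) := by
    rw [hg, hf.retMap_add_int, retMap, ← Function.iterate_add_apply]; push_cast; ring
  have hglt : g (f^[k] x + m) < g z := hf.retMap_strictMono q p hlt
  rcases lt_or_ge k q' with hkq | hkq
  · have := hbig (q + k) (by omega) (m - p) (by rw [← hgk]; exact hglt.le)
    rw [← hgk] at this
    exact absurd (hf.lt_retMap hL.pos (f^[k] x + m)) (not_lt.2 this)
  · obtain ⟨j, rfl⟩ := Nat.exists_eq_add_of_le hkq
    have e : f^[q' + j] x = f^[q'] (f^[j] x) := Function.iterate_add_apply _ _ _ _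
    have h1 := hf.retMap_lt_retMap (a := q') (m := p') (b := 0) (p := 0)
      (by simpa using hL.neg) (f^[j] x)
    have h2 := hf.retMap_lt_retMap (a := 0) (m := 0) (b := q + q') (p := p + p')
      (by have := hL.lt; push_cast; linarith) (f^[j] x)
    have h3 : retMap f (q + q') (p + p') (f^[j] x) = g (f^[q' + j] x + m) - m - p' := by
      rw [hg, hf.retMap_add_int, e]
      simp only [retMap, Function.iterate_add_apply]; push_cast; ring
    simp only [retMap, Function.iterate_zero, id, Int.cast_zero, sub_zero] at h1 h2
    simp only [retMap] at h3
    have := hbig j (by omega) (m + p') (by push_cast at h3 h2 ⊢; linarith)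
    rw [e] at this
    push_cast at this; linarith

theorem IrrationalLift.exists_min_gap (hf : IrrationalLift f ρ) (q : ℕ) (p : ℤ) :
    ∃ z, ∀ x, retMap f q p z - z ≤ retMap f q p x - x := by
  have hc : ContinuousOn (fun x => retMap f q p x - x) (Icc 0 1) :=
    ((hf.retMap_continuous q p).sub continuous_id).continuousOn
  obtain ⟨z, -, hz⟩ := isCompact_Icc.exists_isMinOn (nonempty_Icc.2 zero_le_one) hc
  refine ⟨z, fun x => ?_⟩
  have := hz ⟨Int.fract_nonneg x, (Int.fract_lt_one x).le⟩
  simp only [mem_ofPred_eq] at this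
  have e : x = Int.fract x + ⌊x⌋ := (Int.fract_add_floor x).symm
  rw [e, hf.retMap_add_int]
  linarith

/-- Consecutive fundamental domains of `x ↦ f^q(x) - p` are comparable with constant `K`. -/
def GapsComparable (f : ℝ → ℝ) (q : ℕ) (p : ℤ) (K : ℝ) : Prop :=
  ∀ x, |retMap f q p (retMap f q p x) - retMap f q p x| ≤ K * |retMap f q p x - x| ∧
    |retMap f q p x - x| ≤ K * |retMap f q p (retMap f q p x) - retMap f q p x|

theorem GapsComparable.of_reflect {K : ℝ} (h : GapsComparable (reflect f) q (-p) K) :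
    GapsComparable f q p K := by
  intro x
  have := h (-x)
  simp only [retMap_reflect, neg_neg, neg_sub_neg] at this
  rw [abs_sub_comm _ x, abs_sub_comm _ (retMap f q p x)]
  exact this

/-- The comparability constant for consecutive fundamental domains provided by a bound `B` on the
distortion of cross-ratios. -/
def gapConst (B : ℝ) : ℝ := B * (1 + 4 * (4 * B) ^ 3) ^ 2

theorem WindowCrossRatioBound.gapsComparable (hf : IrrationalLift f ρ) (hL : IsLevel ρ q p q' p')
    {B : ℝ} (hB : 1 ≤ B) (hw : WindowCrossRatioBound f q p q' B) :
    GapsComparable f q p (gapConst B) := by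
  set g := retMap f q p with hg
  have hgx : ∀ x, x < g x := hf.lt_retMap hL.pos
  have hgm : StrictMono g := hf.retMap_strictMono q p
  have hfg : ∀ k x, f^[k] (g x) = g (f^[k] x) := fun k x => hf.iterate_retMap k q p x
  have hgs : Function.Surjective g := hf.retMap_surjective q p
  have hB0 : 0 < B := by linarith
  have hcr : ∀ x, ∀ k ≤ 3 * q', ∀ m : ℝ, crossRatio (f^[k] x - m) (f^[k] (g x) - m)
      (f^[k] (g (g x)) - m) (f^[k] (g (g (g x))) - m) ≤
      B * crossRatio x (g x) (g (g x)) (g (g (g x))) := fun x k hk m => by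
    rw [crossRatio_sub]
    exact hw x _ _ _ _ le_rfl (hgx _) (hgx _) (hgx _) le_rfl k hk
  obtain ⟨z, hz⟩ := hf.exists_min_gap q p
  rw [← hg] at hz
  obtain ⟨z3, rfl⟩ := hgs z
  obtain ⟨z2, rfl⟩ := hgs z3
  obtain ⟨z1, rfl⟩ := hgs z2
  obtain ⟨z0, rfl⟩ := hgs z1
  set G : ℕ → ℝ := fun j => g^[j] z0 with hG
  have hG' : ∀ j, g (G j) = G (j + 1) := fun j => (Function.iterate_succ_apply' g j z0).symm
  have e0 : G 0 = z0 := rfl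
  have e1 : g z0 = G 1 := rfl
  have e2 : g (g z0) = G 2 := rfl
  have e3 : g (g (g z0)) = G 3 := rfl
  have e4 : g (g (g (g z0))) = G 4 := rfl
  rw [e4, hG'] at hz
  have hmin4 := hz (G 3)
  have hmin5 := hz (G 5)
  rw [hG'] at hmin4 hmin5
  have hpos := hgx (G 4)
  rw [hG'] at hpos
  have hbase : (4 : ℝ)⁻¹ ≤ crossRatio (G 3) (G 4) (G 5) (G 6) := by
    have := inv_sq_le_crossRatio (a := G 3) (b := G 4) (c := G 5) (e := G 6) zero_le_one
      (by rw [← hG' 3]; exact hgx _) hpos (by rw [← hG' 5]; exact hgx _)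
      (by linarith) (by linarith)
    norm_num at this
    linarith
  have hgit : ∀ i x, ∃ m : ℤ, ∀ y, g^[i] (y + x) = f^[i * q] (y + x) - m := by
    intro i x
    refine ⟨i * p, fun y => ?_⟩
    generalize y + x = t
    induction i with
    | zero => simp
    | succ i ih =>
      rw [Function.iterate_succ_apply', ih, hg, retMap, hf.iterate_sub_int,
        ← Function.iterate_add_apply, show q + i * q = (i + 1) * q by ring]
      push_cast; ring
  have hpull : ∀ i j, i ≤ 3 → j + i = 3 →
      G (j + 2) - G (j + 1) ≤ 4 * B * (G (j + 3) - G (j + 2)) := by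
    intro i j hi hij
    obtain ⟨m, hm⟩ := hgit i 0
    simp only [add_zero] at hm
    have hk : i * q ≤ 3 * q' := Nat.mul_le_mul hi hL.le
    have h := hcr (G j) (i * q) hk m
    rw [hG', hG', hG', ← hm, ← hm, ← hm, ← hm] at h
    simp only [hG, ← Function.iterate_add_apply] at h
    rw [show i + j = 3 by omega, show i + (j + 1) = 4 by omega, show i + (j + 1 + 1) = 5 by omega,
      show i + (j + 1 + 1 + 1) = 6 by omega] at h
    have h' : (4 * B)⁻¹ ≤ crossRatio (G j) (G (j + 1)) (G (j + 2)) (G (j + 3)) := by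
      rw [mul_inv, mul_comm, inv_mul_le_iff₀ hB0]
      exact hbase.trans h
    have := mul_le_right_of_le_crossRatio (by positivity) (by rw [← hG' j]; exact hgx _)
      (by rw [← hG' (j + 1)]; exact hgx _) (by rw [← hG' (j + 2)]; exact hgx _) h'
    rwa [inv_mul_le_iff₀ (by positivity)] at this
  have p2 := hpull 1 2 (by norm_num) (by norm_num)
  have p1 := hpull 2 1 (by norm_num) (by norm_num)
  have p0 := hpull 3 0 (by norm_num) (by norm_num)
  norm_num at p0 p1 p2
  set r := G 5 - G 4 with hr
  have hr0 : 0 < r := by linarith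
  set E := 4 * (4 * B) ^ 3 with hE
  have hb4 : 1 ≤ 4 * B := by linarith
  have hwin : G 5 - G 1 ≤ E * r := by
    have s3 : G 4 - G 3 ≤ 4 * B * r := by linarith
    have s2 : G 3 - G 2 ≤ (4 * B) ^ 2 * r := by
      calc _ ≤ 4 * B * (G 4 - G 3) := by linarith
        _ ≤ 4 * B * (4 * B * r) := mul_le_mul_of_nonneg_left s3 (by positivity)
        _ = _ := by ring
    have s1 : G 2 - G 1 ≤ (4 * B) ^ 3 * r := by
      calc _ ≤ 4 * B * (G 3 - G 2) := by linarith
        _ ≤ 4 * B * ((4 * B) ^ 2 * r) := mul_le_mul_of_nonneg_left s2 (by positivity)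
        _ = _ := by ring
    have t3 : 4 * B * r ≤ (4 * B) ^ 3 * r :=
      mul_le_mul_of_nonneg_right (le_self_pow₀ hb4 (by norm_num)) hr0.le
    have t2 : (4 * B) ^ 2 * r ≤ (4 * B) ^ 3 * r :=
      mul_le_mul_of_nonneg_right (pow_le_pow_right₀ hb4 (by norm_num)) hr0.le
    have t4 : r ≤ (4 * B) ^ 3 * r := le_mul_of_one_le_left hr0.le (one_le_pow₀ hb4)
    rw [hE]; linarith
  have hE0 : 0 ≤ E := by positivity
  have key : ∀ x, g (g x) - g x ≤ gapConst B * (g x - x) ∧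
      g (g x) - g x ≤ gapConst B * (g (g (g x)) - g (g x)) := by
    intro x
    obtain ⟨k, hk, m, h1, h2⟩ := hL.exists_iterate_mem hf x (G 1)
    rw [← hg, hG'] at h2
    have hk3 : k ≤ 3 * q' := by have := hL.le; omega
    have h := hcr x k hk3 (((-m : ℤ) : ℝ))
    simp only [hfg] at h
    have hgm' : ∀ t, g t - ((-m : ℤ) : ℝ) = g (t - ((-m : ℤ) : ℝ)) := fun t => by
      have := hf.retMap_add_int q p m t
      rw [← hg] at this
      push_cast; simp only [sub_neg_eq_add]; exact this.symm
    simp only [hgm'] at h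
    set u := f^[k] x - ((-m : ℤ) : ℝ) with hu
    have hu' : u = f^[k] x + m := by rw [hu]; push_cast; ring
    have hu1 : G 1 ≤ u := by rw [hu']; exact h1
    have hu2 : u ≤ G 2 := by rw [hu']; exact h2
    have v1 := hgm.monotone hu2
    have v2 := hgm.monotone v1
    have v3 := hgm.monotone v2
    simp only [hG'] at v1 v2 v3
    have m0 := hz u
    have m2 := hz (g (g u))
    have w0 := hgx u
    have w1 := hgx (g u)
    have w2 := hgx (g (g u))
    have hM : g (g u) - g u ≤ E * r := by linarith
    have q1 : E * r ≤ E * (g u - u) := mul_le_mul_of_nonneg_left m0 hE0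
    have q2 : E * r ≤ E * (g (g (g u)) - g (g u)) := mul_le_mul_of_nonneg_left m2 hE0
    have hlow := inv_sq_le_crossRatio hE0 w0 w1 w2 (by linarith) (by linarith)
    have hx : (gapConst B)⁻¹ ≤ crossRatio x (g x) (g (g x)) (g (g (g x))) := by
      rw [gapConst, mul_inv, inv_mul_le_iff₀ hB0]
      exact hlow.trans h
    have hK0 : 0 < gapConst B := by unfold gapConst; positivity
    have r1 := mul_le_left_of_le_crossRatio (inv_nonneg.2 hK0.le) (hgx _) (hgx _) (hgx _) hx
    have r2 := mul_le_right_of_le_crossRatio (inv_nonneg.2 hK0.le) (hgx _) (hgx _) (hgx _) hx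
    rw [inv_mul_le_iff₀ hK0] at r1 r2
    exact ⟨r1, r2⟩
  intro x
  rw [← hg, abs_of_pos (sub_pos.2 (hgx _)), abs_of_pos (sub_pos.2 (hgx _))]
  refine ⟨(key x).1, ?_⟩
  obtain ⟨y, rfl⟩ := hgs x
  exact (key y).2

end Level

section Comparison

variable {f : ℝ → ℝ} {ρ : ℝ} {q q' : ℕ} {p p' : ℤ} {K : ℝ}

theorem one_le_gapConst {B : ℝ} (hB : 1 ≤ B) : 1 ≤ gapConst B := by
  unfold gapConst
  have h : 1 ≤ (1 + 4 * (4 * B) ^ 3) ^ 2 :=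
    one_le_pow₀ (by nlinarith [pow_pos (by linarith : 0 < 4 * B) 3])
  nlinarith

theorem GapsComparable.mono {K' : ℝ} (h : GapsComparable f q p K) (hK : K ≤ K') :
    GapsComparable f q p K' := fun x =>
  ⟨(h x).1.trans (mul_le_mul_of_nonneg_right hK (abs_nonneg _)),
    (h x).2.trans (mul_le_mul_of_nonneg_right hK (abs_nonneg _))⟩

theorem GapsComparable.right (h : GapsComparable f q p K) (hg : ∀ x, x < retMap f q p x) (x : ℝ) :
    retMap f q p (retMap f q p x) - retMap f q p x ≤ K * (retMap f q p x - x) ∧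
      retMap f q p x - x ≤ K * (retMap f q p (retMap f q p x) - retMap f q p x) := by
  have := h x
  rwa [abs_of_pos (sub_pos.2 (hg _)), abs_of_pos (sub_pos.2 (hg _))] at this

theorem GapsComparable.left (h : GapsComparable f q p K) (hg : ∀ x, retMap f q p x < x) (x : ℝ) :
    retMap f q p x - retMap f q p (retMap f q p x) ≤ K * (x - retMap f q p x) ∧
      x - retMap f q p x ≤ K * (retMap f q p x - retMap f q p (retMap f q p x)) := by
  have := h x
  rwa [abs_of_neg (sub_neg.2 (hg _)), abs_of_neg (sub_neg.2 (hg _)), neg_sub, neg_sub] at this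

theorem IsLevel.lt_comp (hf : IrrationalLift f ρ) (hL : IsLevel ρ q p q' p') (x : ℝ) :
    x < retMap f q' p' (retMap f q p x) := by
  rw [hf.retMap_retMap]
  exact hf.lt_retMap (by have := hL.lt; push_cast; linarith) x

/-- The short backward return is controlled by the long forward return. -/
theorem IsLevel.backward_le (hf : IrrationalLift f ρ) (hL : IsLevel ρ q p q' p')
    (hg : GapsComparable f q p K) (x : ℝ) :
    x - retMap f q' p' x ≤ K * (retMap f q p x - x) := by
  obtain ⟨x', rfl⟩ := hf.retMap_surjective q p x
  have h1 := (hg.right (hf.lt_retMap hL.pos) x').2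
  have h2 := hL.lt_comp hf x'
  linarith

theorem GapsComparable.shrink (hf : IrrationalLift f ρ) {q'' : ℕ} {p'' : ℤ} (hK : 0 ≤ K)
    (hh : GapsComparable f q' p' K) (hneg : q' * ρ - p' < 0)
    (h1 : q'' * ρ - p'' ≤ (q * ρ - p) + (q' * ρ - p'))
    (h2 : (q'' * ρ - p'') + (q' * ρ - p') ≤ 0) (x : ℝ) :
    (K + 1) * (retMap f q'' p'' x - x) ≤ K * (retMap f q p x - x) := by
  have hlt := hf.retMap_lt hneg
  obtain ⟨w, hw⟩ := hf.retMap_surjective q' p' (retMap f q'' p'' x)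
  have hwx : w ≤ retMap f q p x := by
    refine (hf.retMap_strictMono q' p').le_iff_le.1 ?_
    rw [hw, hf.retMap_retMap]
    exact hf.retMap_le_retMap (by push_cast; linarith) x
  have hyx : retMap f q' p' (retMap f q'' p'' x) ≤ x := by
    rw [hf.retMap_retMap]
    have := hf.retMap_le_retMap (a := q' + q'') (m := p' + p'') (b := 0) (p := 0)
      (by push_cast; linarith) x
    simpa [retMap] using this
  have := (hh.left hlt w).1
  rw [hw] at this
  nlinarith

/-- The comparison constant at a critical point. -/
def critConst (B Q K : ℝ) : ℝ := B * Q * K ^ 2 * ((1 + K) * (1 + K + K ^ 2))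

theorem WindowCrossRatioBound.forward_le_at_critical (hf : IrrationalLift f ρ)
    (hL : IsLevel ρ q p q' p') {B Q c : ℝ} (hB : 0 ≤ B) (hQ : 0 ≤ Q) (hK : 0 ≤ K)
    (hw : WindowCrossRatioBound f q p q' B)
    (hg : GapsComparable f q p K) (hh : GapsComparable f q' p' K)
    (hc : ∀ u, c < u → u ≤ retMap f q p c →
      (f u - f c) * (retMap f q p c - c) ^ 2 ≤ Q * (u - c) ^ 2 * (f (retMap f q p c) - f c)) :
    retMap f q p c - c ≤ critConst B Q K * (c - retMap f q' p' c) := by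
  have hback := hL.backward_le hf hg c
  have hltc := hL.lt_comp hf c
  have hgx := hf.lt_retMap hL.pos
  have hhx := hf.retMap_lt hL.neg
  have hgR := hg.right hgx
  have hhL := hh.left hhx
  have hcomm := hf.retMap_comm q' q p' p
  have hgm := hf.retMap_strictMono q p
  have hhm := hf.retMap_strictMono q' p'
  have hfg := fun x => hf.iterate_retMap 1 q p x
  have hq' : q' - 1 + 1 = q' := by have := hL.q_pos; have := hL.le; omega
  have hit : ∀ x, f^[q' - 1] (f x) - p' = retMap f q' p' x := fun x => by
    rw [retMap, ← Function.iterate_succ_apply, Nat.succ_eq_add_one, hq']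
  simp only [Function.iterate_one] at hfg
  set g := retMap f q p with hgdef
  set h := retMap f q' p' with hhdef
  obtain ⟨y, hy⟩ := hf.retMap_surjective q' p' c
  rw [← hhdef] at hy
  have hcy : c < y := by have := hhx y; rwa [hy] at this
  have hyg : y < g c := by
    refine hhm.lt_iff_lt.1 ?_
    rw [hy]; exact hltc
  have hgg : g c < g (g c) := hgx _
  have hcr := hw (f c) (f c) (f y) (f (g c)) (f (g (g c))) le_rfl (hf.mono hcy) (hf.mono hyg)
    (hf.mono hgg) (by
      rw [hfg, hfg]; exact hgm.monotone (hgm.monotone (hgx _).le)) (q' - 1) (by omega)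
  rw [← crossRatio_sub (p' : ℝ), hit, hit, hit, hit, hy] at hcr
  have hup := hcr.trans (mul_le_mul_of_nonneg_left
    (crossRatio_le_left (hf.mono hcy) (hf.mono hyg) (hf.mono hgg)) hB)
  set S := g c - c with hS
  set s' := c - h c with hs'
  have hS0 : 0 < S := sub_pos.2 (hgx c)
  have hs0 : 0 < s' := sub_pos.2 (hhx c)
  have hys : y - c ≤ K * s' := by
    have := (hhL y).2
    rwa [hy] at this
  have hfS : 0 < f (g c) - f c := sub_pos.2 (hf.mono (hgx c))
  have hquo : (f y - f c) / (f (g c) - f c) ≤ Q * (K * s') ^ 2 / S ^ 2 := by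
    rw [div_le_div_iff₀ hfS (by positivity)]
    refine (hc y hcy hyg.le).trans ?_
    have : (y - c) ^ 2 ≤ (K * s') ^ 2 := pow_le_pow_left₀ (by linarith) hys 2
    exact mul_le_mul_of_nonneg_right (mul_le_mul_of_nonneg_left this hQ) hfS.le
  have hlow : s' / ((1 + K) * S) * (1 / (1 + K + K ^ 2)) ≤
      crossRatio (h c) c (h (g c)) (h (g (g c))) := by
    have hR : 0 < h (g (g c)) - h (g c) := sub_pos.2 (hhm hgg)
    have e1 : h (g c) ≤ g c := (hhx _).le
    have e2 : h (g (g c)) = g (h (g c)) := hcomm _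
    have e3 : g (g c) ≤ g (g (h (g c))) := hgm.monotone (hgm.monotone hltc.le)
    have e4 := (hgR c).2
    have e5 := (hgR (h (g c))).1
    rw [← e2] at e5
    have e6 : S ≤ K * ((1 + K) * (h (g (g c)) - h (g c))) := by
      refine e4.trans (mul_le_mul_of_nonneg_left ?_ hK)
      rw [← e2] at e3
      linarith
    unfold crossRatio
    rw [div_mul_div_comm, div_le_div_iff₀ (by positivity)
      (mul_pos (by linarith) (by linarith)), mul_one]
    have a1 : h (g c) - h c ≤ (1 + K) * S := by linarith
    have a2 : h (g (g c)) - c ≤ (1 + K + K ^ 2) * (h (g (g c)) - h (g c)) := by nlinarith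
    have := mul_le_mul a1 a2 (by linarith) (by positivity)
    calc _ ≤ s' * ((1 + K) * S * ((1 + K + K ^ 2) * (h (g (g c)) - h (g c)))) :=
          mul_le_mul_of_nonneg_left this hs0.le
      _ = _ := by ring
  have hall := hlow.trans (hup.trans (mul_le_mul_of_nonneg_left hquo hB))
  rw [div_mul_div_comm, mul_div_assoc', div_le_div_iff₀ (by positivity) (by positivity)] at hall
  have : s' * S * S ≤ s' * S * (critConst B Q K * s') := by
    unfold critConst; nlinarith
  exact le_of_mul_le_mul_left this (by positivity)

/-- The comparison constant along the critical orbit. -/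
def orbitConst (B M K : ℝ) : ℝ := B * (1 + ((M + 1 + K) * K ^ 2 + K)) ^ 2

theorem WindowCrossRatioBound.forward_le (hf : IrrationalLift f ρ)
    (hL : IsLevel ρ q p q' p') {B M c : ℝ} (hB : 0 < B) (hM : 0 ≤ M) (hK : 0 ≤ K)
    (hw : WindowCrossRatioBound f q p q' B)
    (hg : GapsComparable f q p K) (hh : GapsComparable f q' p' K)
    (hc : retMap f q p c - c ≤ M * (c - retMap f q' p' c)) {k : ℕ} (hk : k ≤ q + q') :
    retMap f q p (f^[k] c) - f^[k] c ≤
      orbitConst B M K * (f^[k] c - retMap f q' p' (f^[k] c)) := by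
  have hlt := hL.lt_comp hf
  have hgx := hf.lt_retMap hL.pos
  have hhx := hf.retMap_lt hL.neg
  have hgR := hg.right hgx
  have hhL := hh.left hhx
  have hgm := hf.retMap_strictMono q p
  have hhm := hf.retMap_strictMono q' p'
  have hle := hL.le
  obtain ⟨m, hm⟩ := Nat.exists_eq_add_of_le (show k ≤ 2 * q' by omega)
  have hmg := fun x => hf.iterate_retMap m q p x
  have hmh := fun x => hf.iterate_retMap m q' p' x
  have hgi := hf.retMap_add_int q p
  have hhi := hf.retMap_add_int q' p'
  have hend : f^[m] (f^[k] c) = retMap f q' p' (retMap f q' p' c) + ((2 * p' : ℤ) : ℝ) := by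
    rw [← Function.iterate_add_apply, show m + k = q' + q' by omega, hf.retMap_retMap, retMap]
    push_cast; ring
  set g := retMap f q p with hgdef
  set h := retMap f q' p' with hhdef
  set x := f^[k] c with hx
  set y := h (h c) with hy
  obtain ⟨x', hx'⟩ := hf.retMap_surjective q p x
  rw [← hgdef] at hx'
  have hx'h : x' ≤ h x := by rw [← hx']; exact (hlt x').le
  have hcr := hw x' (h x) x (g x) (g (g x)) hx'h (hhx x) (hgx x) (hgx _)
    (by rw [← hgdef, hx']) m (by omega)
  simp only [hmg, hmh, hend, hgi, hhi] at hcr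
  rw [← crossRatio_sub ((2 * p' : ℤ) : ℝ)] at hcr
  simp only [add_sub_cancel_right] at hcr
  set E := (M + 1 + K) * K ^ 2 + K with hE
  have hE0 : 0 ≤ E := by positivity
  have hy0 : 0 < y - h y := sub_pos.2 (hhx y)
  have b1 := (hhL c).1
  have b2 := (hhL c).2
  have b3 := (hhL (h c)).2
  have b4 : g y ≤ g c := hgm.monotone (by rw [hy]; linarith [hhx c, hhx (h c)])
  have b5 : c - h c ≤ K ^ 2 * (y - h y) := by
    calc _ ≤ K * (h c - h (h c)) := b2
      _ ≤ K * (K * (h (h c) - h (h (h c)))) := mul_le_mul_of_nonneg_left b3 hK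
      _ = _ := by rw [hy]; ring
  have b6 : g y - y ≤ E * (y - h y) := by
    have : g y - y ≤ (M + 1 + K) * (c - h c) := by rw [hy]; rw [hy] at b4; linarith
    have h2 : (M + 1 + K) * (c - h c) ≤ (M + 1 + K) * (K ^ 2 * (y - h y)) :=
      mul_le_mul_of_nonneg_left b5 (by positivity)
    have h3 : 0 ≤ K * (y - h y) := by positivity
    rw [hE]; linarith
  have b7 : g y - y ≤ E * (g (g y) - g y) := by
    have h1 := (hgR y).2
    have h2 := hgx (g y)
    have h3 : 0 ≤ (M + 1 + K) * K ^ 2 * (g (g y) - g y) :=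
      mul_nonneg (by positivity) (by linarith)
    rw [hE]; linarith
  have hlow := (inv_sq_le_crossRatio hE0 (hhx y) (hgx y) (hgx _) b6 b7).trans hcr
  have hfin : (orbitConst B M K)⁻¹ ≤ crossRatio (h x) x (g x) (g (g x)) := by
    rw [orbitConst, mul_inv, inv_mul_le_iff₀ hB]
    exact hlow
  have hO : 0 < orbitConst B M K := by unfold orbitConst; positivity
  have := mul_le_left_of_le_crossRatio (inv_nonneg.2 hO.le) (hhx x) (hgx x) (hgx _) hfin
  rwa [inv_mul_le_iff₀ hO] at this

end Comparison

section Smooth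

theorem slope_diff_le_of_monotoneOn_deriv {ψ : ℝ → ℝ} {I : Set ℝ} (hI : Convex ℝ I) (hIo : IsOpen I)
    (hd : DifferentiableOn ℝ ψ I) (hm : MonotoneOn (deriv ψ) I) {x y z : ℝ} (hx : x ∈ I)
    (hz : z ∈ I) (hxy : x < y) (hyz : y < z) :
    (ψ y - ψ x) / (y - x) ≤ (ψ z - ψ y) / (z - y) := by
  have hc : ConvexOn ℝ I ψ := by
    refine MonotoneOn.convexOn_of_deriv hI hd.continuousOn ?_ ?_ <;> rw [hIo.interior_eq]
    exacts [hd, hm]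
  exact hc.slope_mono_adjacent hx hz hxy hyz

/-- The second divided differences of a `C²` function are close to half its second derivative. -/
theorem exists_second_difference_close {φ : ℝ → ℝ} {W : Set ℝ} {p : ℝ} (hW : IsOpen W) (hp : p ∈ W)
    (hφ : ContDiffOn ℝ 2 φ W) {η : ℝ} (hη : 0 < η) :
    ∃ δ > 0, ∀ x y z, p - δ < x → x < y → y < z → z < p + δ →
      |((φ z - φ y) / (z - y) - (φ y - φ x) / (y - x)) - deriv (deriv φ) p / 2 * (z - x)| ≤
        η * (z - x) := by
  have h1 : ContDiffOn ℝ 1 (deriv φ) W := hφ.deriv_of_isOpen hW (by norm_num)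
  have hs : HasStrictDerivAt (deriv φ) (deriv (deriv φ) p) p :=
    (h1.contDiffAt (hW.mem_nhds hp)).hasStrictDerivAt (by norm_num)
  set A := deriv (deriv φ) p with hA
  have hs' := (hasStrictDerivAt_iff_hasStrictFDerivAt.1 hs).isLittleO.def
    (show 0 < 2 * η by positivity)
  rw [nhds_prod_eq] at hs'
  obtain ⟨t, ht, hs'⟩ := Filter.eventually_prod_self_iff'.1 hs'
  obtain ⟨δ, hδ, hball⟩ := Metric.mem_nhds_iff.1 (Filter.inter_mem ht (hW.mem_nhds hp))
  refine ⟨δ, hδ, fun x y z hx hxy hyz hz => ?_⟩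
  rw [Real.ball_eq_Ioo] at hball
  have hI : Convex ℝ (Ioo (p - δ) (p + δ)) := convex_Ioo _ _
  have hx' : x ∈ Ioo (p - δ) (p + δ) := ⟨hx, by linarith⟩
  have hz' : z ∈ Ioo (p - δ) (p + δ) := ⟨by linarith, hz⟩
  have hd : ∀ x ∈ Ioo (p - δ) (p + δ), DifferentiableAt ℝ φ x := fun x hx =>
    (hφ.contDiffAt (hW.mem_nhds (hball hx).2)).differentiableAt (by norm_num)
  have hest : ∀ x ∈ Ioo (p - δ) (p + δ), ∀ y ∈ Ioo (p - δ) (p + δ), x ≤ y →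
      |deriv φ y - deriv φ x - A * (y - x)| ≤ 2 * η * (y - x) := fun x hx y hy hxy => by
    have := hs' y (hball hy).1 x (hball hx).1
    simp only [ContinuousLinearMap.toSpanSingleton_apply, smul_eq_mul, Real.norm_eq_abs,
      abs_of_nonneg (sub_nonneg.2 hxy)] at this
    rwa [mul_comm A]
  have key : ∀ (σ B : ℝ), (∀ x ∈ Ioo (p - δ) (p + δ), ∀ y ∈ Ioo (p - δ) (p + δ), x ≤ y →
      0 ≤ σ * (deriv φ y - deriv φ x) + 2 * B * (y - x)) →
      0 ≤ σ * ((φ z - φ y) / (z - y) - (φ y - φ x) / (y - x)) + B * (z - x) := by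
    intro σ B hσ
    have hder : ∀ x ∈ Ioo (p - δ) (p + δ), HasDerivAt (fun x => σ * φ x + B * x ^ 2)
        (σ * deriv φ x + B * (2 * x)) x := fun x hx => by
      simpa using ((hd x hx).hasDerivAt.const_mul σ).fun_add ((hasDerivAt_pow 2 x).const_mul B)
    have := slope_diff_le_of_monotoneOn_deriv (ψ := fun x => σ * φ x + B * x ^ 2) hI isOpen_Ioo
      (fun x hx => (hder x hx).differentiableAt.differentiableWithinAt)
      (fun x hx y hy hxy => by
        rw [(hder x hx).deriv, (hder y hy).deriv]
        linarith [hσ x hx y hy hxy]) hx' hz' hxy hyz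
    have e1 : ∀ u v : ℝ, u < v → ((σ * φ v + B * v ^ 2) - (σ * φ u + B * u ^ 2)) / (v - u) =
        σ * ((φ v - φ u) / (v - u)) + B * (v + u) := fun u v huv => by
      have : v - u ≠ 0 := (sub_pos.2 huv).ne'
      field_simp; ring
    simp only [e1 _ _ hxy, e1 _ _ hyz] at this
    linarith
  have k1 := key 1 (η - A / 2) fun x hx y hy hxy => by
    have := (abs_le.1 (hest x hx y hy hxy)).1
    linarith
  have k2 := key (-1) (η + A / 2) fun x hx y hy hxy => by
    have := (abs_le.1 (hest x hx y hy hxy)).2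
    linarith
  rw [abs_le]
  constructor <;> linarith

theorem crossRatio_map_le_of_slopes {φ : ℝ → ℝ} {a b c e E : ℝ} (hab : a < b) (hbc : b < c)
    (hce : c < e) (h1 : φ a < φ b) (h2 : φ b < φ c) (h3 : φ c < φ e)
    (h : (φ b - φ a) / (b - a) * ((φ e - φ c) / (e - c)) ≤
      E * ((φ c - φ a) / (c - a) * ((φ e - φ b) / (e - b)))) :
    crossRatio (φ a) (φ b) (φ c) (φ e) ≤ E * crossRatio a b c e := by
  have n1 : 0 < b - a := by linarith
  have n2 : 0 < e - c := by linarith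
  have n3 : 0 < c - a := by linarith
  have n4 : 0 < e - b := by linarith
  have n5 : 0 < φ c - φ a := by linarith
  have n6 : 0 < φ e - φ b := by linarith
  unfold crossRatio
  rw [div_mul_div_comm, div_mul_div_comm, mul_div_assoc', div_le_div_iff₀ (by positivity)
    (by positivity)] at h
  rw [mul_div_assoc', div_le_div_iff₀ (by positivity) (by positivity)]
  linarith

theorem slopes_mul_le {s₁ s₂ α β A D η l L : ℝ} (hη0 : 0 ≤ η) (hηD : η < D) (hl : 0 < l)
    (hlη : l ≤ 2 * η) (hl1 : l ≤ 1) (hL : l ≤ L)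
    (hη : 2 * η * (D + η) + (|A| + η) * (2 * η) + 2 * η * (|A| + η) ^ 2 ≤ (D - η) ^ 2 / 2)
    (hA1 : |α - A| ≤ η) (hA2 : |β - A| ≤ η) (hS1 : |s₁ - D| ≤ η) (hS2 : |s₂ - D| ≤ η) :
    s₁ * s₂ ≤ Real.exp L * ((s₁ + l * α) * (s₂ - l * β)) := by
  have hs1' := abs_le.1 hS1
  have hs2' := abs_le.1 hS2
  have hDη : 0 < D - η := by linarith
  have hαβ : |α - β| ≤ 2 * η := by
    have := abs_sub_le α A β
    rw [abs_sub_comm A β] at this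
    linarith
  have hss' : |s₁ - s₂| ≤ 2 * η := by
    have := abs_sub_le s₁ D s₂
    rw [abs_sub_comm D s₂] at this
    linarith
  have hα' : |α| ≤ |A| + η := by have := abs_sub_abs_le_abs_sub α A; linarith
  have hβ' : |β| ≤ |A| + η := by have := abs_sub_abs_le_abs_sub β A; linarith
  have hmain : -((D - η) ^ 2 / 2) ≤ (α * s₂ - β * s₁) - l * (α * β) := by
    have t1 : |(α - β) * s₂| ≤ 2 * η * (D + η) := by
      rw [abs_mul]
      refine mul_le_mul hαβ ?_ (abs_nonneg _) (by positivity)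
      rw [abs_of_pos (by linarith)]; linarith
    have t2 : |β * (s₁ - s₂)| ≤ (|A| + η) * (2 * η) := by
      rw [abs_mul]
      exact mul_le_mul hβ' hss' (abs_nonneg _) (by positivity)
    have t3 : |l * (α * β)| ≤ 2 * η * (|A| + η) ^ 2 := by
      rw [abs_mul, abs_mul, abs_of_pos hl, sq]
      exact mul_le_mul hlη (mul_le_mul hα' hβ' (abs_nonneg _) (by positivity))
        (by positivity) (by positivity)
    have u1 := (abs_le.1 t1).1
    have u2 := (abs_le.1 t2).2
    have u3 := (abs_le.1 t3).2
    have : α * s₂ - β * s₁ = (α - β) * s₂ - β * (s₁ - s₂) := by ring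
    linarith
  have hprod : (D - η) ^ 2 ≤ s₁ * s₂ := by
    rw [sq]; exact mul_le_mul (by linarith) (by linarith) hDη.le (by linarith)
  have hP : (1 - l / 2) * (s₁ * s₂) ≤ (s₁ + l * α) * (s₂ - l * β) := by
    have : (s₁ + l * α) * (s₂ - l * β) =
        s₁ * s₂ + l * ((α * s₂ - β * s₁) - l * (α * β)) := by ring
    rw [this]
    have h2 : l * (-(s₁ * s₂ / 2)) ≤ l * ((α * s₂ - β * s₁) - l * (α * β)) :=
      mul_le_mul_of_nonneg_left (by linarith) hl.le
    linarith
  have hsp : 0 < s₁ * s₂ := lt_of_lt_of_le (by positivity) hprod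
  have hexp : 1 ≤ Real.exp L * (1 - l / 2) := by
    have h1 : Real.exp l ≤ Real.exp L := Real.exp_le_exp.2 hL
    have h2 := Real.add_one_le_exp l
    have h3 : 1 ≤ (l + 1) * (1 - l / 2) := by nlinarith
    exact h3.trans (mul_le_mul_of_nonneg_right (h2.trans h1) (by linarith))
  calc s₁ * s₂ ≤ (Real.exp L * (1 - l / 2)) * (s₁ * s₂) := le_mul_of_one_le_left hsp.le hexp
    _ = Real.exp L * ((1 - l / 2) * (s₁ * s₂)) := by ring
    _ ≤ _ := mul_le_mul_of_nonneg_left hP (Real.exp_pos _).le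

/-- `C²` diffeomorphisms distort small cross-ratios by a factor close to one. -/
theorem exists_crossRatio_le_of_contDiffOn {φ : ℝ → ℝ} {W : Set ℝ} {p : ℝ} (hW : IsOpen W)
    (hp : p ∈ W) (hφ : ContDiffOn ℝ 2 φ W) (hpos : 0 < deriv φ p) :
    ∃ δ > 0, (∀ x y, p - δ < x → x < y → y < p + δ →
        deriv φ p / 2 * (y - x) ≤ φ y - φ x ∧ φ y - φ x ≤ 2 * deriv φ p * (y - x)) ∧
      ∀ a b c e, p - δ < a → a < b → b < c → c < e → e < p + δ →
        crossRatio (φ a) (φ b) (φ c) (φ e) ≤ Real.exp (e - a) * crossRatio a b c e := by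
  set D := deriv φ p with hD
  set A := deriv (deriv φ) p / 2 with hA
  obtain ⟨η, hη0, hηD, hη⟩ : ∃ η > 0, η ≤ D / 2 ∧
      2 * η * (D + η) + (|A| + η) * (2 * η) + 2 * η * (|A| + η) ^ 2 ≤ (D - η) ^ 2 / 2 := by
    have hc : ContinuousAt (fun η : ℝ => (D - η) ^ 2 / 2 -
      (2 * η * (D + η) + (|A| + η) * (2 * η) + 2 * η * (|A| + η) ^ 2)) 0 := by fun_prop
    have h0 := hc.eventually_mem (Ioi_mem_nhds (show 0 < _ by norm_num; positivity))
    have h1 : ∀ᶠ η : ℝ in 𝓝 0, η < D / 2 := gt_mem_nhds (by positivity)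
    obtain ⟨η, ⟨h2, h3⟩, h4⟩ := (((h0.and h1).filter_mono nhdsWithin_le_nhds).and
      (self_mem_nhdsWithin (s := Ioi (0 : ℝ)))).exists
    have h2' := mem_Ioi.1 h2
    exact ⟨η, h4, h3.le, by linarith⟩
  obtain ⟨δ₁, hδ₁, hdd⟩ := exists_second_difference_close hW hp hφ hη0
  have hs : HasStrictDerivAt φ D p :=
    (hφ.contDiffAt (hW.mem_nhds hp)).hasStrictDerivAt (by norm_num)
  have hs' := (hasStrictDerivAt_iff_hasStrictFDerivAt.1 hs).isLittleO.def hη0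
  rw [nhds_prod_eq] at hs'
  obtain ⟨t, ht, hs'⟩ := Filter.eventually_prod_self_iff'.1 hs'
  obtain ⟨δ₂, hδ₂, hball⟩ := Metric.mem_nhds_iff.1 ht
  rw [Real.ball_eq_Ioo] at hball
  have hη1 : 0 < min η (1 / 2) := lt_min hη0 (by norm_num)
  set δ := min (min δ₁ δ₂) (min η (1 / 2)) with hδ
  have d1 : δ ≤ δ₁ := (min_le_left _ _).trans (min_le_left _ _)
  have d2 : δ ≤ δ₂ := (min_le_left _ _).trans (min_le_right _ _)
  have d3 : δ ≤ η := (min_le_right _ _).trans (min_le_left _ _)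
  have d4 : δ ≤ 1 / 2 := (min_le_right _ _).trans (min_le_right _ _)
  have hest : ∀ x y, p - δ < x → x < y → y < p + δ →
      |φ y - φ x - D * (y - x)| ≤ η * (y - x) := fun x y hx hxy hy => by
    have := hs' y (hball ⟨by linarith, by linarith⟩ : y ∈ t) x
      (hball ⟨by linarith, by linarith⟩ : x ∈ t)
    simp only [ContinuousLinearMap.toSpanSingleton_apply, smul_eq_mul, Real.norm_eq_abs,
      abs_of_pos (sub_pos.2 hxy)] at this
    rwa [mul_comm D]
  have hsl : ∀ x y, p - δ < x → x < y → y < p + δ →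
      |(φ y - φ x) / (y - x) - D| ≤ η := fun x y hx hxy hy => by
    have h := hest x y hx hxy hy
    have h0 : 0 < y - x := sub_pos.2 hxy
    have : (φ y - φ x) / (y - x) - D = (φ y - φ x - D * (y - x)) / (y - x) := by
      field_simp
    rw [this, abs_div, abs_of_pos h0, div_le_iff₀ h0]
    exact h
  have hbd : ∀ x y, p - δ < x → x < y → y < p + δ →
      D / 2 * (y - x) ≤ φ y - φ x ∧ φ y - φ x ≤ 2 * D * (y - x) := fun x y hx hxy hy => by
    have h := abs_le.1 (hest x y hx hxy hy)
    have h0 : 0 < y - x := sub_pos.2 hxy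
    have h1 : η * (y - x) ≤ D / 2 * (y - x) := mul_le_mul_of_nonneg_right hηD h0.le
    have h2 : 0 ≤ D * (y - x) := by positivity
    constructor <;> linarith [h.1, h.2]
  refine ⟨δ, by positivity, hbd, fun a b c e ha hab hbc hce he => ?_⟩
  have hlt : ∀ x y, p - δ < x → x < y → y < p + δ → φ x < φ y := fun x y hx hxy hy => by
    have h := (hbd x y hx hxy hy).1
    have h0 : 0 < D / 2 * (y - x) := mul_pos (by positivity) (sub_pos.2 hxy)
    linarith
  have i1 := hlt a b (by linarith) hab (by linarith)
  have i2 := hlt b c (by linarith) hbc (by linarith)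
  have i3 := hlt c e (by linarith) hce (by linarith)
  refine crossRatio_map_le_of_slopes hab hbc hce i1 i2 i3 ?_
  have n1 : 0 < b - a := by linarith
  have n2 : 0 < e - c := by linarith
  have n3 : 0 < c - a := by linarith
  have n4 : 0 < e - b := by linarith
  have n5 : 0 < c - b := by linarith
  set s₁ := (φ b - φ a) / (b - a) with hs₁
  set s₂ := (φ e - φ c) / (e - c) with hs₂
  set s := (φ c - φ b) / (c - b) with hss
  obtain ⟨α, hα⟩ : ∃ α, α = (s - s₁) / (c - a) := ⟨_, rfl⟩
  obtain ⟨β, hβ⟩ : ∃ β, β = (s₂ - s) / (e - b) := ⟨_, rfl⟩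
  have ea : (φ c - φ a) / (c - a) = s₁ + (c - b) * α := by
    rw [hα, hss, hs₁]; field_simp; ring
  have eb : (φ e - φ b) / (e - b) = s₂ - (c - b) * β := by
    rw [hβ, hss, hs₂]; field_simp; ring
  have hA1 : |α - A| ≤ η := by
    have := hdd a b c (by linarith) hab hbc (by linarith)
    rw [← hA, ← hss, ← hs₁] at this
    have e : α - A = ((s - s₁) - A * (c - a)) / (c - a) := by rw [hα]; field_simp
    rw [e, abs_div, abs_of_pos n3, div_le_iff₀ n3]
    exact this
  have hA2 : |β - A| ≤ η := by
    have := hdd b c e (by linarith) hbc hce (by linarith)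
    rw [← hA, ← hss, ← hs₂] at this
    have e : β - A = ((s₂ - s) - A * (e - b)) / (e - b) := by rw [hβ]; field_simp
    rw [e, abs_div, abs_of_pos n4, div_le_iff₀ n4]
    exact this
  have hS1 : |s₁ - D| ≤ η := hsl a b (by linarith) hab (by linarith)
  have hS2 : |s₂ - D| ≤ η := hsl c e (by linarith) hce (by linarith)
  rw [ea, eb]
  exact slopes_mul_le hη0.le (by linarith) n5 (by linarith) (by linarith) (by linarith) hη hA1 hA2
    hS1 hS2

end Smooth

section Power

variable {d a b c e x y : ℝ}

/-- The odd power map `x ↦ x |x|^(d-1)`. -/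
def oddPow (d x : ℝ) : ℝ := x * |x| ^ (d - 1)

theorem oddPow_neg (d x : ℝ) : oddPow d (-x) = -oddPow d x := by
  simp [oddPow]

theorem oddPow_of_nonneg (hd : 0 < d) (hx : 0 ≤ x) : oddPow d x = x ^ d := by
  rcases hx.eq_or_lt with rfl | hx
  · simp [oddPow, Real.zero_rpow hd.ne']
  · rw [oddPow, abs_of_pos hx, Real.rpow_sub_one hx.ne', mul_div_cancel₀ _ hx.ne']

theorem oddPow_zero (d : ℝ) : oddPow d 0 = 0 := by simp [oddPow]

theorem oddPow_strictMono (hd : 0 < d) : StrictMono (oddPow d) := by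
  have hpos : ∀ x y, 0 ≤ x → x < y → oddPow d x < oddPow d y := fun x y hx hxy => by
    rw [oddPow_of_nonneg hd hx, oddPow_of_nonneg hd (hx.trans hxy.le)]
    exact Real.rpow_lt_rpow hx hxy hd
  intro x y hxy
  rcases le_or_gt 0 x with hx | hx
  · exact hpos x y hx hxy
  · have hx0 : oddPow d x < 0 := by
      have := hpos 0 (-x) le_rfl (by linarith)
      rw [oddPow_zero, oddPow_neg] at this
      linarith
    rcases le_or_gt y 0 with hy | hy
    · have := hpos (-y) (-x) (by linarith) (by linarith)
      rw [oddPow_neg, oddPow_neg] at this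
      linarith
    · have := hpos 0 y le_rfl hy
      rw [oddPow_zero] at this
      linarith

theorem oddPow_eq (d x : ℝ) : oddPow d x = |x| ^ (d - 1) * x := mul_comm _ _

theorem oddPow_sub_le_of_nonneg (hd : 1 ≤ d) (hx : 0 ≤ x) (hxy : x ≤ y) :
    oddPow d y - oddPow d x ≤ d * y ^ (d - 1) * (y - x) := by
  rcases hxy.eq_or_lt with rfl | hxy
  · simp
  have hy : 0 < y := by linarith
  rw [oddPow_of_nonneg (by linarith) hx, oddPow_of_nonneg (by linarith) hy.le]
  have h := one_add_mul_self_le_rpow_one_add (s := x / y - 1) (by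
    have : 0 ≤ x / y := by positivity
    linarith) hd
  rw [show 1 + (x / y - 1) = x / y by ring, Real.div_rpow hx hy.le,
    le_div_iff₀ (Real.rpow_pos_of_pos hy d)] at h
  have e : y ^ d = y ^ (d - 1) * y := by
    rw [Real.rpow_sub_one hy.ne', div_mul_cancel₀ _ hy.ne']
  rw [e] at h ⊢
  have : (1 + d * (x / y - 1)) * (y ^ (d - 1) * y) =
      y ^ (d - 1) * y + d * y ^ (d - 1) * (x - y) := by
    field_simp
  linarith

theorem oddPow_sub_le (hd : 1 ≤ d) {M : ℝ} (hxy : x ≤ y) (hx : |x| ≤ M) (hy : |y| ≤ M) :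
    oddPow d y - oddPow d x ≤ d * M ^ (d - 1) * (y - x) := by
  have hd1 : 0 ≤ d - 1 := by linarith
  have hM : ∀ z, |z| ≤ M → |z| ^ (d - 1) ≤ M ^ (d - 1) := fun z hz =>
    Real.rpow_le_rpow (abs_nonneg _) hz hd1
  have hd0 : 0 ≤ d := by linarith
  rcases le_or_gt 0 x with h0 | h0
  · refine (oddPow_sub_le_of_nonneg hd h0 hxy).trans ?_
    have := hM y hy
    rw [abs_of_nonneg (h0.trans hxy)] at this
    gcongr
  rcases le_or_gt y 0 with h1 | h1
  · have h := oddPow_sub_le_of_nonneg hd (x := -y) (y := -x) (by linarith) (by linarith)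
    rw [oddPow_neg, oddPow_neg] at h
    have := hM x hx
    rw [abs_of_neg h0] at this
    have h2 : d * (-x) ^ (d - 1) * (-x - -y) ≤ d * M ^ (d - 1) * (-x - -y) := by
      gcongr
      linarith
    linarith
  · have e1 : oddPow d y ≤ M ^ (d - 1) * y := by
      rw [oddPow_eq]; exact mul_le_mul_of_nonneg_right (hM y hy) h1.le
    have e2 : M ^ (d - 1) * x ≤ oddPow d x := by
      rw [oddPow_eq]; exact mul_le_mul_of_nonpos_right (hM x hx) h0.le
    have h3 : 0 ≤ M ^ (d - 1) := Real.rpow_nonneg ((abs_nonneg _).trans hx) _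
    have h4 : M ^ (d - 1) * (y - x) ≤ d * (M ^ (d - 1) * (y - x)) :=
      le_mul_of_one_le_left (mul_nonneg h3 (by linarith)) hd
    linarith

theorem le_oddPow_sub (hd : 1 ≤ d) (hxy : x < y) :
    max |x| |y| ^ (d - 1) * (y - x) ≤ 2 * (oddPow d y - oddPow d x) := by
  have hd1 : 0 ≤ d - 1 := by linarith
  have hpos : ∀ x y, 0 ≤ x → x < y →
      y ^ (d - 1) * (y - x) ≤ oddPow d y - oddPow d x := fun x y hx hxy => by
    rw [oddPow_eq, oddPow_eq, abs_of_nonneg hx, abs_of_nonneg (hx.trans hxy.le)]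
    have : x ^ (d - 1) * x ≤ y ^ (d - 1) * x := by gcongr
    linarith
  have hinc := oddPow_strictMono (d := d) (by linarith) hxy
  rcases le_or_gt 0 x with h0 | h0
  · have : max |x| |y| = y := by
      rw [abs_of_nonneg h0, abs_of_nonneg (h0.trans hxy.le), max_eq_right hxy.le]
    rw [this]
    have := hpos x y h0 hxy
    linarith
  rcases le_or_gt y 0 with h1 | h1
  · have : max |x| |y| = -x := by
      rw [abs_of_neg h0, abs_of_nonpos h1, max_eq_left (by linarith)]
    rw [this]
    have := hpos (-y) (-x) (by linarith) (by linarith)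
    rw [oddPow_neg, oddPow_neg] at this
    linarith
  · rw [abs_of_neg h0, abs_of_pos h1]
    have hy0 : 0 ≤ y ^ (d - 1) := Real.rpow_nonneg h1.le _
    have hx0 : 0 ≤ (-x) ^ (d - 1) := Real.rpow_nonneg (by linarith) _
    have ey := oddPow_eq d y
    have ex := oddPow_eq d x
    rw [abs_of_pos h1] at ey
    rw [abs_of_neg h0] at ex
    have m1 := mul_nonneg hx0 (neg_nonneg.2 h0.le)
    have m2 := mul_nonneg hy0 h1.le
    rcases le_total (-x) y with h | h
    · rw [max_eq_right h]
      have := mul_le_mul_of_nonneg_left h hy0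
      linarith
    · rw [max_eq_left h]
      have := mul_le_mul_of_nonneg_left h hx0
      linarith

theorem oddPow_slope_le (hd : 1 ≤ d) (hab : a < b) (hbc : b < c) :
    (oddPow d b - oddPow d a) / (b - a) ≤
      2 * d * ((oddPow d c - oddPow d a) / (c - a)) := by
  have h1 := le_oddPow_sub hd (hab.trans hbc)
  have h2 := oddPow_sub_le hd (M := max |a| |c|) hab.le (le_max_left _ _)
    (abs_le_max_abs_abs hab.le hbc.le)
  have n1 : 0 < b - a := by linarith
  have n2 : 0 < c - a := by linarith
  calc _ ≤ d * max |a| |c| ^ (d - 1) := by rwa [div_le_iff₀ n1]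
    _ ≤ _ := by
      rw [mul_div_assoc', le_div_iff₀ n2]
      have := mul_le_mul_of_nonneg_left h1 (show 0 ≤ d by linarith)
      linarith

theorem crossRatio_oddPow_le (hd : 1 ≤ d) (hab : a < b) (hbc : b < c) (hce : c < e) :
    crossRatio (oddPow d a) (oddPow d b) (oddPow d c) (oddPow d e) ≤
      4 * d ^ 2 * crossRatio a b c e := by
  have hm := oddPow_strictMono (d := d) (by linarith)
  refine crossRatio_map_le_of_slopes hab hbc hce (hm hab) (hm hbc) (hm hce) ?_
  have h1 := oddPow_slope_le hd hab hbc
  have h2 := oddPow_slope_le hd (a := -e) (b := -c) (c := -b) (by linarith) (by linarith)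
  simp only [oddPow_neg, neg_sub_neg] at h2
  have p1 : 0 ≤ (oddPow d e - oddPow d c) / (e - c) :=
    div_nonneg (sub_nonneg.2 (hm hce).le) (by linarith)
  have p2 : 0 ≤ (oddPow d c - oddPow d a) / (c - a) :=
    div_nonneg (sub_nonneg.2 (hm (hab.trans hbc)).le) (by linarith)
  calc _ ≤ (2 * d * ((oddPow d c - oddPow d a) / (c - a))) *
        (2 * d * ((oddPow d e - oddPow d b) / (e - b))) :=
        mul_le_mul h1 h2 p1 (mul_nonneg (by linarith) p2)
    _ = _ := by ring

theorem sinh_mul_div_sinh_monotoneOn (hd : 1 ≤ d) :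
    MonotoneOn (fun x => Real.sinh (d * x) / Real.sinh x) (Ioi 0) := by
  have hnum : ∀ x, 0 ≤ x →
      0 ≤ d * Real.cosh (d * x) * Real.sinh x - Real.sinh (d * x) * Real.cosh x := by
    have hder : ∀ x, HasDerivAt (fun x => d * Real.cosh (d * x) * Real.sinh x -
        Real.sinh (d * x) * Real.cosh x) ((d ^ 2 - 1) * (Real.sinh (d * x) * Real.sinh x)) x := by
      intro x
      have hl : HasDerivAt (fun x => d * x) d x := by simpa using (hasDerivAt_id x).const_mul d
      have h1 := ((hl.cosh.const_mul d).mul (Real.hasDerivAt_sinh x)).sub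
        (hl.sinh.mul (Real.hasDerivAt_cosh x))
      refine h1.congr_deriv ?_
      ring
    have hm : MonotoneOn (fun x => d * Real.cosh (d * x) * Real.sinh x -
        Real.sinh (d * x) * Real.cosh x) (Ici 0) := by
      refine monotoneOn_of_deriv_nonneg (convex_Ici 0)
        (fun x _ => (hder x).continuousAt.continuousWithinAt)
        (fun x _ => (hder x).differentiableAt.differentiableWithinAt) fun x hx => ?_
      rw [interior_Ici] at hx
      have hx0 : 0 < x := hx
      rw [(hder x).deriv]
      have : 0 ≤ d ^ 2 - 1 := by nlinarith
      exact mul_nonneg this (mul_nonneg (Real.sinh_nonneg_iff.2 (by positivity))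
        (Real.sinh_nonneg_iff.2 hx0.le))
    intro x hx
    simpa using hm (mem_Ici.2 le_rfl) (mem_Ici.2 hx) hx
  have hder : ∀ x, 0 < x → HasDerivAt (fun x => Real.sinh (d * x) / Real.sinh x)
      ((d * Real.cosh (d * x) * Real.sinh x - Real.sinh (d * x) * Real.cosh x) /
        Real.sinh x ^ 2) x := by
    intro x hx
    have hl : HasDerivAt (fun x => d * x) d x := by simpa using (hasDerivAt_id x).const_mul d
    refine (hl.sinh.div (Real.hasDerivAt_sinh x) (Real.sinh_pos_iff.2 hx).ne').congr_deriv ?_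
    ring
  refine monotoneOn_of_deriv_nonneg (convex_Ioi 0)
    (fun x hx => (hder x hx).continuousAt.continuousWithinAt)
    (fun x hx => (hder x (interior_subset hx)).differentiableAt.differentiableWithinAt)
    fun x hx => ?_
  rw [interior_Ioi] at hx
  have hx0 : 0 < x := hx
  rw [(hder x hx0).deriv]
  exact div_nonneg (hnum x hx0.le) (sq_nonneg _)

theorem exp_sub_exp (u v : ℝ) :
    Real.exp v - Real.exp u = 2 * Real.exp ((u + v) / 2) * Real.sinh ((v - u) / 2) := by
  rw [Real.sinh_eq]
  have h1 : Real.exp v = Real.exp ((u + v) / 2) * Real.exp ((v - u) / 2) := by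
    rw [← Real.exp_add]; ring_nf
  have h2 : Real.exp u = Real.exp ((u + v) / 2) * Real.exp (-((v - u) / 2)) := by
    rw [← Real.exp_add]; ring_nf
  rw [h1, h2]; ring

theorem rpow_slope_eq {u v : ℝ} (huv : u < v) :
    (oddPow d (Real.exp v) - oddPow d (Real.exp u)) / (Real.exp v - Real.exp u) =
      Real.exp ((d - 1) / 2 * (u + v)) *
        (Real.sinh (d * ((v - u) / 2)) / Real.sinh ((v - u) / 2)) := by
  have hP : ∀ t, oddPow d (Real.exp t) = Real.exp (d * t) := fun t => by
    rw [oddPow, abs_of_pos (Real.exp_pos _), ← Real.exp_mul, ← Real.exp_add]; ring_nf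
  rw [hP, hP, exp_sub_exp, exp_sub_exp]
  have h1 : Real.sinh ((v - u) / 2) ≠ 0 := (Real.sinh_pos_iff.2 (by linarith)).ne'
  have h2 : Real.exp ((d * u + d * v) / 2) =
      Real.exp ((d - 1) / 2 * (u + v)) * Real.exp ((u + v) / 2) := by
    rw [← Real.exp_add]; ring_nf
  rw [h2, show (d * v - d * u) / 2 = d * ((v - u) / 2) by ring]
  have h3 := (Real.exp_pos ((u + v) / 2)).ne'
  field_simp

theorem crossRatio_oddPow_le_of_pos (hd : 1 ≤ d) (ha : 0 < a) (hab : a < b) (hbc : b < c)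
    (hce : c < e) :
    crossRatio (oddPow d a) (oddPow d b) (oddPow d c) (oddPow d e) ≤ crossRatio a b c e := by
  have hm := oddPow_strictMono (d := d) (by linarith)
  rw [← one_mul (crossRatio a b c e)]
  refine crossRatio_map_le_of_slopes hab hbc hce (hm hab) (hm hbc) (hm hce) ?_
  obtain ⟨a, rfl⟩ : ∃ t, Real.exp t = a := ⟨_, Real.exp_log ha⟩
  obtain ⟨b, rfl⟩ : ∃ t, Real.exp t = b := ⟨_, Real.exp_log (ha.trans hab)⟩
  obtain ⟨c, rfl⟩ : ∃ t, Real.exp t = c := ⟨_, Real.exp_log (ha.trans (hab.trans hbc))⟩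
  obtain ⟨e, rfl⟩ : ∃ t, Real.exp t = e :=
    ⟨_, Real.exp_log (ha.trans (hab.trans (hbc.trans hce)))⟩
  rw [Real.exp_lt_exp] at hab hbc hce
  rw [rpow_slope_eq hab, rpow_slope_eq hce, rpow_slope_eq (hab.trans hbc),
    rpow_slope_eq (hbc.trans hce), one_mul]
  have hG := sinh_mul_div_sinh_monotoneOn hd
  have g1 := hG (mem_Ioi.2 (show 0 < (b - a) / 2 by linarith))
    (mem_Ioi.2 (show 0 < (c - a) / 2 by linarith)) (by linarith)
  have g2 := hG (mem_Ioi.2 (show 0 < (e - c) / 2 by linarith))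
    (mem_Ioi.2 (show 0 < (e - b) / 2 by linarith)) (by linarith)
  have hpos : ∀ x, 0 < x → 0 ≤ Real.sinh (d * x) / Real.sinh x := fun x hx =>
    div_nonneg (Real.sinh_nonneg_iff.2 (by positivity)) (Real.sinh_nonneg_iff.2 hx.le)
  have hexp : Real.exp ((d - 1) / 2 * (a + b)) * Real.exp ((d - 1) / 2 * (c + e)) =
      Real.exp ((d - 1) / 2 * (a + c)) * Real.exp ((d - 1) / 2 * (b + e)) := by
    rw [← Real.exp_add, ← Real.exp_add]; ring_nf
  rw [mul_mul_mul_comm (Real.exp ((d - 1) / 2 * (a + b))),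
    mul_mul_mul_comm (Real.exp ((d - 1) / 2 * (a + c))), hexp]
  exact mul_le_mul_of_nonneg_left (mul_le_mul g1 g2 (hpos _ (by linarith))
    (hpos _ (by linarith))) (by positivity)

theorem crossRatio_oddPow_le_of_nonneg (hd : 1 ≤ d) (ha : 0 ≤ a) (hab : a < b) (hbc : b < c)
    (hce : c < e) :
    crossRatio (oddPow d a) (oddPow d b) (oddPow d c) (oddPow d e) ≤ crossRatio a b c e := by
  rcases ha.lt_or_eq with ha | rfl
  · exact crossRatio_oddPow_le_of_pos hd ha hab hbc hce
  have hm := oddPow_strictMono (d := d) (by linarith)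
  have hcont : Continuous (oddPow d) := by
    unfold oddPow
    exact continuous_id.mul (continuous_abs.rpow_const fun _ => Or.inr (by linarith))
  have hev : ∀ᶠ t in 𝓝[>] (0 : ℝ), crossRatio (oddPow d t) (oddPow d b) (oddPow d c) (oddPow d e) ≤
      crossRatio t b c e := by
    filter_upwards [Ioo_mem_nhdsGT hab] with t ht
    exact crossRatio_oddPow_le_of_pos hd ht.1 ht.2 hbc hce
  have n1 : (oddPow d c - oddPow d 0) * (oddPow d e - oddPow d b) ≠ 0 :=
    (mul_pos (sub_pos.2 (hm (hab.trans hbc))) (sub_pos.2 (hm (hbc.trans hce)))).ne'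
  have n2 : (c - 0) * (e - b) ≠ 0 := (mul_pos (by linarith) (by linarith)).ne'
  have t1 : Tendsto (fun t => crossRatio (oddPow d t) (oddPow d b) (oddPow d c) (oddPow d e))
      (𝓝[>] 0) (𝓝 (crossRatio (oddPow d 0) (oddPow d b) (oddPow d c) (oddPow d e))) := by
    have : ContinuousAt
        (fun t => crossRatio (oddPow d t) (oddPow d b) (oddPow d c) (oddPow d e)) 0 := by
      unfold crossRatio
      exact ContinuousAt.div (by fun_prop) (by fun_prop) n1
    exact this.tendsto.mono_left nhdsWithin_le_nhds
  have t2 : Tendsto (fun t => crossRatio t b c e) (𝓝[>] 0) (𝓝 (crossRatio 0 b c e)) := by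
    have : ContinuousAt (fun t => crossRatio t b c e) 0 := by
      unfold crossRatio
      exact ContinuousAt.div (by fun_prop) (by fun_prop) n2
    exact this.tendsto.mono_left nhdsWithin_le_nhds
  exact le_of_tendsto_of_tendsto t1 t2 hev

theorem crossRatio_oddPow_le_of_nonpos (hd : 1 ≤ d) (he : e ≤ 0) (hab : a < b) (hbc : b < c)
    (hce : c < e) :
    crossRatio (oddPow d a) (oddPow d b) (oddPow d c) (oddPow d e) ≤ crossRatio a b c e := by
  have := crossRatio_oddPow_le_of_nonneg hd (neg_nonneg.2 he) (neg_lt_neg hce) (neg_lt_neg hbc)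
    (neg_lt_neg hab)
  simpa only [oddPow_neg, crossRatio_neg] using this

end Power

section Local

variable {f : ℝ → ℝ} {C : Finset ℝ} {dc : ℝ → ℝ} {c₀ d D : ℝ}

/-- Near a critical point, a strictly increasing `f` is a power map in an increasing coordinate. -/
theorem IsNonFlatCritPt.exists_coordinate (hf : StrictMono f) (h : IsNonFlatCritPt f c₀ d) :
    ∃ (φ : ℝ → ℝ) (A δ : ℝ), 0 < A ∧ 0 < δ ∧ φ c₀ = 0 ∧
      (∀ x ∈ Ioo (c₀ - δ) (c₀ + δ), f x = f c₀ + oddPow d (φ x)) ∧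
      (∀ x y, c₀ - δ < x → x < y → y < c₀ + δ →
        A / 2 * (y - x) ≤ φ y - φ x ∧ φ y - φ x ≤ 2 * A * (y - x)) ∧
      ∀ a b c e, c₀ - δ < a → a < b → b < c → c < e → e < c₀ + δ →
        crossRatio (φ a) (φ b) (φ c) (φ e) ≤ Real.exp (e - a) * crossRatio a b c e := by
  obtain ⟨hd, W, φ, hW, hc, hφ, h0, hder, -, hfφ⟩ := h
  have hφ2 : ContDiffOn ℝ 2 φ W := hφ.of_le (by norm_num)
  obtain ⟨r, hr, hball⟩ := Metric.isOpen_iff.1 hW c₀ hc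
  rw [Real.ball_eq_Ioo] at hball
  have hpos : 0 < deriv φ c₀ := by
    by_contra! hle
    have hneg : 0 < deriv (fun x => -φ x) c₀ := by
      rw [deriv.fun_neg]
      have := hder c₀ hc
      have := lt_of_le_of_ne hle this
      linarith
    obtain ⟨δ, hδ, hlow, -⟩ := exists_crossRatio_le_of_contDiffOn hW hc hφ2.neg hneg
    have hm : 0 < min δ r := lt_min hδ hr
    have m1 := min_le_left δ r
    have m2 := min_le_right δ r
    have h1 := (hlow c₀ (c₀ + min δ r / 2) (by linarith) (by linarith) (by linarith)).1
    have h2 : 0 < deriv (fun x => -φ x) c₀ / 2 * (c₀ + min δ r / 2 - c₀) :=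
      mul_pos (by positivity) (by linarith)
    have h3 : φ (c₀ + min δ r / 2) < 0 := by
      have := h1
      simp only [h0] at this
      linarith
    have h4 := hf (show c₀ < c₀ + min δ r / 2 by linarith)
    rw [hfφ (c₀ + min δ r / 2) (hball ⟨by linarith, by linarith⟩)] at h4
    have h5 := oddPow_strictMono (d := d) (by linarith) h3
    rw [oddPow_zero, oddPow] at h5
    linarith
  obtain ⟨δ, hδ, hbd, hcr⟩ := exists_crossRatio_le_of_contDiffOn hW hc hφ2 hpos
  have m1 := min_le_left δ r
  have m2 := min_le_right δ r
  exact ⟨φ, deriv φ c₀, min δ r, hpos, lt_min hδ hr, h0,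
    fun x hx => hfφ x (hball ⟨by linarith [hx.1], by linarith [hx.2]⟩),
    fun x y hx hxy hy => hbd x y (by linarith) hxy (by linarith),
    fun a b c e ha hab hbc hce he => hcr a b c e (by linarith) hab hbc hce (by linarith)⟩

theorem IsNonFlatCritPt.exists_crossRatio_le (hf : StrictMono f) (h : IsNonFlatCritPt f c₀ d)
    (hD : d ≤ D) :
    ∃ δ > 0, ∀ a b c e, c₀ - δ < a → a < b → b < c → c < e → e < c₀ + δ →
      ((¬ (a < c₀ ∧ c₀ < e)) →
        crossRatio (f a) (f b) (f c) (f e) ≤ Real.exp (e - a) * crossRatio a b c e) ∧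
      crossRatio (f a) (f b) (f c) (f e) ≤
        Real.exp (e - a + Real.log (4 * D ^ 2)) * crossRatio a b c e := by
  obtain ⟨φ, A, δ, hA, hδ, h0, hfφ, hbd, hcr⟩ := h.exists_coordinate hf
  have hd := h.1
  refine ⟨δ, hδ, fun a b c e ha hab hbc hce he => ?_⟩
  have hφ : ∀ x y, c₀ - δ < x → x < y → y < c₀ + δ → φ x < φ y := fun x y hx hxy hy => by
    have h1 := (hbd x y hx hxy hy).1
    have h2 : 0 < A / 2 * (y - x) := mul_pos (by positivity) (sub_pos.2 hxy)
    linarith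
  have i1 := hφ a b ha hab (by linarith)
  have i2 := hφ b c (by linarith) hbc (by linarith)
  have i3 := hφ c e (by linarith) hce he
  have hfe : crossRatio (f a) (f b) (f c) (f e) =
      crossRatio (oddPow d (φ a)) (oddPow d (φ b)) (oddPow d (φ c)) (oddPow d (φ e)) := by
    rw [← crossRatio_sub (f c₀), hfφ a ⟨ha, by linarith⟩, hfφ b ⟨by linarith, by linarith⟩,
      hfφ c ⟨by linarith, by linarith⟩, hfφ e ⟨by linarith, he⟩]
    simp only [add_sub_cancel_left]
  have hφcr := hcr a b c e ha hab hbc hce he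
  rw [hfe]
  constructor
  · intro hn
    rw [not_and_or, not_lt, not_lt] at hn
    refine le_trans ?_ hφcr
    rcases hn with hn | hn
    · refine crossRatio_oddPow_le_of_nonneg hd.le ?_ i1 i2 i3
      rcases hn.eq_or_lt with rfl | hn
      · exact h0.ge
      · have := hφ c₀ a (by linarith) hn (by linarith)
        linarith
    · refine crossRatio_oddPow_le_of_nonpos hd.le ?_ i1 i2 i3
      rcases hn.eq_or_lt with rfl | hn
      · exact h0.le
      · have := hφ e c₀ (by linarith) hn (by linarith)
        linarith
  · have hD0 : 0 < D := by linarith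
    rw [Real.exp_add, Real.exp_log (by positivity)]
    have hp := (crossRatio_pos i1 i2 i3).le
    calc _ ≤ 4 * d ^ 2 * crossRatio (φ a) (φ b) (φ c) (φ e) :=
          crossRatio_oddPow_le hd.le i1 i2 i3
      _ ≤ 4 * D ^ 2 * crossRatio (φ a) (φ b) (φ c) (φ e) := by gcongr
      _ ≤ 4 * D ^ 2 * (Real.exp (e - a) * crossRatio a b c e) := by gcongr
      _ = _ := by ring

open Classical in
theorem IsMulticriticalLift.exists_crossRatio_le_near (h : IsMulticriticalLift f C dc)
    (hD : ∀ c ∈ C, dc c ≤ D) (hD1 : 1 ≤ D) (x : ℝ) :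
    ∃ δ > 0, ∀ a b c e, x - δ < a → a < b → b < c → c < e → e < x + δ →
      crossRatio (f a) (f b) (f c) (f e) ≤
        Real.exp (e - a + if ∃ s ∈ C, ∃ m : ℤ, a < s + m ∧ s + m < e then Real.log (4 * D ^ 2)
          else 0) * crossRatio a b c e := by
  obtain ⟨hf, -, -, hcrit, hflat⟩ := h
  have hΛ : 0 ≤ Real.log (4 * D ^ 2) := Real.log_nonneg (by nlinarith)
  have hper : ∀ (m : ℤ) x, f (x + m) = f x + m := fun m x => by
    have h1 : ∀ x, f (x + 1) = f x + 1 := hf.periodic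
    induction m using Int.induction_on generalizing x with
    | zero => simp
    | succ m ih => push_cast at ih ⊢; rw [← add_assoc, h1, ih]; ring
    | pred m ih =>
      have := h1 (x + ((-m - 1 : ℤ) : ℝ))
      have h2 := ih x
      push_cast at this h2 ⊢
      rw [show x + (-(m : ℝ) - 1) + 1 = x + -m by ring] at this
      linarith
  by_cases hx : deriv f x = 0
  · obtain ⟨s, hs, k, rfl⟩ := (hcrit x).1 hx
    obtain ⟨δ, hδ, hloc⟩ := (hflat s hs).exists_crossRatio_le hf.mono (hD s hs)
    refine ⟨δ, hδ, fun a b c e ha hab hbc hce he => ?_⟩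
    have := hloc (a - k) (b - k) (c - k) (e - k) (by linarith) (by linarith) (by linarith)
      (by linarith) (by linarith)
    have hk : ∀ y, f (y - k) = f y - k := fun y => by
      have := hper k (y - k)
      rw [sub_add_cancel] at this; linarith
    simp only [hk, crossRatio_sub, sub_sub_sub_cancel_right] at this
    split_ifs with hC
    · exact this.2
    · rw [add_zero]
      refine this.1 fun hse => hC ⟨s, hs, k, by linarith [hse.1], by linarith [hse.2]⟩
  · have hpos : 0 < deriv f x := lt_of_le_of_ne (hf.mono.monotone.deriv_nonneg) (Ne.symm hx)
    obtain ⟨δ, hδ, -, hloc⟩ := exists_crossRatio_le_of_contDiffOn isOpen_univ (mem_univ x)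
      ((hf.smooth.of_le (by norm_num)).contDiffOn (s := univ)) hpos
    refine ⟨δ, hδ, fun a b c e ha hab hbc hce he => ?_⟩
    refine (hloc a b c e ha hab hbc hce he).trans ?_
    refine mul_le_mul_of_nonneg_right (Real.exp_le_exp.2 ?_) (crossRatio_pos hab hbc hce).le
    split_ifs <;> linarith

open Classical in
/-- Small cross-ratios are distorted by a factor depending only on the criticalities. -/
theorem IsMulticriticalLift.exists_localCrossRatioBound (h : IsMulticriticalLift f C dc)
    (hD : ∀ c ∈ C, dc c ≤ D) (hD1 : 1 ≤ D) :
    ∃ δ > 0, LocalCrossRatioBound f C 1 δ (Real.log (4 * D ^ 2)) := by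
  choose δ hδ hloc using h.exists_crossRatio_le_near hD hD1
  obtain ⟨r, hr, hleb⟩ := lebesgue_number_lemma_of_metric (s := Icc (0 : ℝ) 1)
    (c := fun x => Ioo (x - δ x) (x + δ x)) isCompact_Icc (fun _ => isOpen_Ioo)
    fun x _ => mem_iUnion.2 ⟨x, by constructor <;> linarith [hδ x]⟩
  refine ⟨r / 2, by positivity, fun a b c e hab hbc hce hae => ?_⟩
  obtain ⟨x, hx⟩ := hleb (Int.fract a) ⟨Int.fract_nonneg a, (Int.fract_lt_one a).le⟩
  rw [Real.ball_eq_Ioo] at hx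
  have hper : ∀ (m : ℤ) x, f (x - m) = f x - m := by
    have h1 : Function.Periodic (fun x => f x - x) 1 := fun x => by
      simp only [h.1.periodic]; ring
    intro m x
    have := h1.sub_int_mul_eq (x := x) m
    simp only [mul_one] at this
    linarith
  have ea : a - ⌊a⌋ = Int.fract a := rfl
  have xa := hx (show Int.fract a ∈ _ by constructor <;> linarith)
  have xe := hx (show e - ⌊a⌋ ∈ _ by constructor <;> linarith)
  have := hloc x (a - ⌊a⌋) (b - ⌊a⌋) (c - ⌊a⌋) (e - ⌊a⌋) (by rw [ea]; exact xa.1) (by linarith)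
    (by linarith) (by linarith) xe.2
  simp only [hper, crossRatio_sub, sub_sub_sub_cancel_right] at this
  rw [one_mul]
  have hiff : (∃ s ∈ C, ∃ m : ℤ, a < s + m ∧ s + m < e) ↔
      ∃ s ∈ C, ∃ m : ℤ, a - ⌊a⌋ < s + m ∧ s + m < e - ⌊a⌋ := by
    constructor
    · rintro ⟨s, hs, m, h1, h2⟩
      exact ⟨s, hs, m - ⌊a⌋, by push_cast; linarith, by push_cast; linarith⟩
    · rintro ⟨s, hs, m, h1, h2⟩
      exact ⟨s, hs, m + ⌊a⌋, by push_cast; linarith, by push_cast; linarith⟩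
  rwa [if_congr hiff rfl rfl]

end Local

section Global

variable {f : ℝ → ℝ} {C : Finset ℝ} {dc : ℝ → ℝ} {κ δ Λ : ℝ}

theorem crossRatio_eq (a b c e : ℝ) :
    crossRatio a b c e = (b - a) / (c - a) * ((e - c) / (e - b)) := by
  rw [crossRatio, div_mul_div_comm]

open Classical in
protected theorem LocalCrossRatioBound.reflect (h : LocalCrossRatioBound f C κ δ Λ) :
    LocalCrossRatioBound (reflect f) (C.image Neg.neg) κ δ Λ := by
  intro a b c e hab hbc hce hae
  have := h (-e) (-c) (-b) (-a) (by linarith) (by linarith) (by linarith) (by linarith)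
  rw [crossRatio_neg, ← crossRatio_neg, neg_sub_neg] at this
  have hiff : (∃ s ∈ C.image Neg.neg, ∃ m : ℤ, a < s + m ∧ s + m < e) ↔
      ∃ s ∈ C, ∃ m : ℤ, -e < s + m ∧ s + m < -a := by
    constructor
    · rintro ⟨s, hs, m, h1, h2⟩
      obtain ⟨t, ht, rfl⟩ := Finset.mem_image.1 hs
      exact ⟨t, ht, -m, by push_cast; linarith, by push_cast; linarith⟩
    · rintro ⟨s, hs, m, h1, h2⟩
      exact ⟨-s, Finset.mem_image_of_mem _ hs, -m, by push_cast; linarith, by push_cast; linarith⟩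
  rwa [if_congr hiff rfl rfl]

theorem IsCircleMapLift.exists_lipschitz (hf : IsCircleMapLift f) :
    ∃ L > 0, ∀ x y, x ≤ y → f y - f x ≤ L * (y - x) := by
  have hd : Differentiable ℝ f := hf.smooth.differentiable (by norm_num)
  have hc : Continuous (deriv f) := hf.smooth.continuous_deriv (by norm_num)
  have hp : Function.Periodic (deriv f) 1 := fun x => by
    have : (fun y => f (y + 1)) = fun y => f y + 1 := funext hf.periodic
    rw [← deriv_comp_add_const, this, deriv_add_const]
  obtain ⟨L, hL⟩ := isCompact_Icc.exists_bound_of_continuousOn (s := Icc (0 : ℝ) 1) hc.continuousOn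
  refine ⟨|L| + 1, by positivity, fun x y hxy => ?_⟩
  refine image_sub_le_mul_sub_of_deriv_le hd (fun z => ?_) hxy
  obtain ⟨w, hw, hzw⟩ := hp.exists_mem_Ico₀ one_pos z
  rw [hzw]
  have := hL w (Ico_subset_Icc_self hw)
  rw [Real.norm_eq_abs] at this
  linarith [le_abs_self (deriv f w), le_abs_self L]

theorem IsCircleMapLift.exists_pos_le_sub (hf : IsCircleMapLift f) {r : ℝ} (hr : 0 < r) :
    ∃ m > 0, ∀ x y, r ≤ y - x → m ≤ f y - f x := by
  have hcont : Continuous f := hf.smooth.continuous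
  obtain ⟨z, -, hz⟩ := (isCompact_Icc (a := (0 : ℝ)) (b := 1)).exists_isMinOn
    (nonempty_Icc.2 zero_le_one) (f := fun x => f (x + r) - f x) (by fun_prop)
  have hp : Function.Periodic (fun x => f (x + r) - f x) 1 := fun x => by
    have : x + 1 + r = x + r + 1 := by ring
    simp only [this, hf.periodic]; ring
  refine ⟨f (z + r) - f z, sub_pos.2 (hf.mono (by linarith)), fun x y hxy => ?_⟩
  obtain ⟨w, hw, hxw⟩ := hp.exists_mem_Ico₀ one_pos x
  have h1 : f (z + r) - f z ≤ f (w + r) - f w := hz (Ico_subset_Icc_self hw)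
  have h2 : f (x + r) ≤ f y := hf.mono.monotone (by linarith)
  linarith

theorem crossRatio_le_of_long_middle {F : ℝ → ℝ} (hF : StrictMono F) {a b c e L m r : ℝ}
    (hab : a < b) (hbc : b < c) (hce : c < e) (he : e - a ≤ 3) (hL : 0 < L) (hm : 0 < m)
    (hLip : ∀ x y, x ≤ y → F y - F x ≤ L * (y - x)) (hlow : ∀ x y, r ≤ y - x → m ≤ F y - F x)
    (hM : r ≤ c - b) :
    crossRatio (F a) (F b) (F c) (F e) ≤ 9 * L ^ 2 / m ^ 2 * crossRatio a b c e := by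
  have h1 := hF hab
  have h2 := hlow b c hM
  have h3 := hF hce
  have u1 := hLip a b hab.le
  have u2 := hLip c e hce.le
  have n1 : 0 < b - a := by linarith
  have n2 : 0 < e - c := by linarith
  have n3 : 0 < c - a := by linarith
  have n4 : 0 < e - b := by linarith
  have t1 : (F b - F a) / (F c - F a) ≤ L * (b - a) / m :=
    div_le_div₀ (by positivity) u1 hm (by linarith)
  have t2 : (F e - F c) / (F e - F b) ≤ L * (e - c) / m :=
    div_le_div₀ (by positivity) u2 hm (by linarith)
  have s1 : (b - a) / 3 ≤ (b - a) / (c - a) := by gcongr; linarith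
  have s2 : (e - c) / 3 ≤ (e - c) / (e - b) := by gcongr; linarith
  rw [crossRatio_eq, crossRatio_eq]
  calc _ ≤ (L * (b - a) / m) * (L * (e - c) / m) :=
        mul_le_mul t1 t2 (div_nonneg (by linarith) (by linarith)) (by positivity)
    _ = 9 * L ^ 2 / m ^ 2 * ((b - a) / 3 * ((e - c) / 3)) := by field_simp; norm_num
    _ ≤ _ := by gcongr

theorem div_le_mul_div_of_truncate {x x' y T m : ℝ} (hy : 0 < y) (hx : 0 < x) (hxx : x ≤ x')
    (hm : 0 < m) (hT : T = (m + 4) / m) (hy4 : y ≤ 4) (h : x = x' ∨ m ≤ x) :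
    x' / (x' + y) ≤ T * (x / (x + y)) := by
  have hT1 : 1 ≤ T := by rw [hT, le_div_iff₀ hm]; linarith
  rcases h with rfl | h
  · exact le_mul_of_one_le_left (by positivity) hT1
  · have h1 : x' / (x' + y) ≤ 1 := by rw [div_le_one (by linarith)]; linarith
    refine h1.trans ?_
    rw [hT, div_mul_div_comm, le_div_iff₀ (by positivity)]
    nlinarith

theorem div_add_le_div_add {x x' y : ℝ} (hy : 0 < y) (hx : 0 < x) (hxx : x ≤ x') :
    x / (x + y) ≤ x' / (x' + y) := by
  rw [div_le_div_iff₀ (by linarith) (by linarith)]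
  nlinarith

open Classical in
theorem LocalCrossRatioBound.exists_extend (hf : IsCircleMapLift f) (hδ : 0 < δ) (hΛ : 0 ≤ Λ)
    (h : LocalCrossRatioBound f C 1 δ Λ) :
    ∃ κ ≥ 0, LocalCrossRatioBound f C κ 3 Λ := by
  obtain ⟨L, hL, hLip⟩ := hf.exists_lipschitz
  obtain ⟨m, hm, hlow⟩ := hf.exists_pos_le_sub (show 0 < δ / 3 by positivity)
  have hper3 : ∀ x, f (x + 3) = f x + 3 := fun x => by
    rw [show x + 3 = x + 1 + 1 + 1 by ring, hf.periodic, hf.periodic, hf.periodic]; ring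
  set T := (m + 4) / m with hT
  have hT1 : 1 ≤ T := by rw [hT, le_div_iff₀ hm]; linarith
  set A := 9 * L ^ 2 / m ^ 2 + T ^ 2 * Real.exp δ with hA
  have hexpδ : 1 ≤ Real.exp δ := Real.one_le_exp hδ.le
  have hA1 : 1 ≤ A := by
    have h1 : 0 ≤ 9 * L ^ 2 / m ^ 2 := by positivity
    have h2 : 1 ≤ T ^ 2 := one_le_pow₀ hT1
    nlinarith
  have hlog : 0 ≤ Real.log A := Real.log_nonneg hA1
  set κ := Real.log A / δ + 1 with hκ
  have hκ1 : 1 ≤ κ := by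
    have : 0 ≤ Real.log A / δ := by positivity
    linarith
  refine ⟨κ, by linarith, fun a b c e hab hbc hce hae => ?_⟩
  set I : ℝ := if ∃ s ∈ C, ∃ m : ℤ, a < s + m ∧ s + m < e then Λ else 0 with hI
  have hI0 : 0 ≤ I := by rw [hI]; split_ifs <;> [exact hΛ; exact le_rfl]
  have hcr := (crossRatio_pos hab hbc hce).le
  rcases le_or_gt (e - a) δ with hsmall | hbig
  · refine (h a b c e hab hbc hce hsmall).trans (mul_le_mul_of_nonneg_right
      (Real.exp_le_exp.2 ?_) hcr)
    have := mul_le_mul_of_nonneg_right hκ1 (show 0 ≤ e - a by linarith)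
    linarith
  have hfac : A * Real.exp I ≤ Real.exp (κ * (e - a) + I) := by
    rw [Real.exp_add]
    refine mul_le_mul_of_nonneg_right ?_ (Real.exp_pos _).le
    rw [← Real.log_le_iff_le_exp (by linarith)]
    have h1 : Real.log A ≤ κ * δ := by
      rw [hκ, add_mul, div_mul_cancel₀ _ hδ.ne']; linarith
    exact h1.trans (mul_le_mul_of_nonneg_left hbig.le (by linarith))
  refine le_trans ?_ (mul_le_mul_of_nonneg_right hfac hcr)
  have hexpI : 1 ≤ Real.exp I := Real.one_le_exp hI0
  rcases le_or_gt (δ / 3) (c - b) with hM | hM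
  · refine (crossRatio_le_of_long_middle hf.mono hab hbc hce hae hL hm hLip hlow hM).trans
      (mul_le_mul_of_nonneg_right ?_ hcr)
    have h1 : 9 * L ^ 2 / m ^ 2 ≤ A := by
      have : 0 ≤ T ^ 2 * Real.exp δ := by positivity
      linarith
    exact h1.trans (le_mul_of_one_le_right (by linarith) hexpI)
  · obtain ⟨a', ha'⟩ : ∃ a', a' = max a (b - δ / 3) := ⟨_, rfl⟩
    obtain ⟨e', he'⟩ : ∃ e', e' = min e (c + δ / 3) := ⟨_, rfl⟩
    have a1 : a ≤ a' := ha' ▸ le_max_left _ _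
    have a2 : b - δ / 3 ≤ a' := ha' ▸ le_max_right _ _
    have a3 : a' < b := ha' ▸ max_lt hab (by linarith)
    have e1 : e' ≤ e := he' ▸ min_le_left _ _
    have e2 : e' ≤ c + δ / 3 := he' ▸ min_le_right _ _
    have e3 : c < e' := he' ▸ lt_min hce (by linarith)
    have hfM : f c - f b ≤ 4 := by
      have : f c ≤ f (b + 3) := hf.mono.monotone (by linarith)
      rw [hper3] at this; linarith
    have hfM0 : 0 < f c - f b := sub_pos.2 (hf.mono hbc)
    have l1 : (f b - f a) / (f c - f a) ≤ T * ((f b - f a') / (f c - f a')) := by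
      have := div_le_mul_div_of_truncate (x := f b - f a') (x' := f b - f a) hfM0
        (sub_pos.2 (hf.mono a3)) (by linarith [hf.mono.monotone a1]) hm hT hfM (by
          rcases max_choice a (b - δ / 3) with h | h
          · left; rw [ha', h]
          · right; exact hlow a' b (by rw [ha', h]; linarith))
      simpa only [sub_add_sub_cancel'] using this
    have r1 : (f e - f c) / (f e - f b) ≤ T * ((f e' - f c) / (f e' - f b)) := by
      have := div_le_mul_div_of_truncate (x := f e' - f c) (x' := f e - f c) hfM0
        (sub_pos.2 (hf.mono e3)) (by linarith [hf.mono.monotone e1]) hm hT hfM (by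
          rcases min_choice e (c + δ / 3) with h | h
          · left; rw [he', h]
          · right; exact hlow c e' (by rw [he', h]; linarith))
      simpa only [sub_add_sub_cancel] using this
    have l2 : (b - a') / (c - a') ≤ (b - a) / (c - a) := by
      have := div_add_le_div_add (x := b - a') (x' := b - a) (sub_pos.2 hbc) (by linarith)
        (by linarith)
      simpa only [sub_add_sub_cancel'] using this
    have r2 : (e' - c) / (e' - b) ≤ (e - c) / (e - b) := by
      have := div_add_le_div_add (x := e' - c) (x' := e - c) (sub_pos.2 hbc) (by linarith)
        (by linarith)
      simpa only [sub_add_sub_cancel] using this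
    have hcr' : crossRatio a' b c e' ≤ crossRatio a b c e := by
      rw [crossRatio_eq, crossRatio_eq]
      exact mul_le_mul l2 r2 (div_nonneg (by linarith) (by linarith))
        (div_nonneg (by linarith) (by linarith))
    have hI' : (if ∃ s ∈ C, ∃ m : ℤ, a' < s + m ∧ s + m < e' then Λ else 0) ≤ I := by
      split_ifs with hex
      · obtain ⟨s, hs, k, h1, h2⟩ := hex
        rw [hI, if_pos ⟨s, hs, k, by linarith, by linarith⟩]
      · exact hI0
    have hloc := h a' b c e' a3 hbc e3 (by linarith)
    have hloc' : crossRatio (f a') (f b) (f c) (f e') ≤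
        Real.exp δ * Real.exp I * crossRatio a b c e := by
      rw [← Real.exp_add]
      refine hloc.trans (mul_le_mul (Real.exp_le_exp.2 (by linarith)) hcr'
        (crossRatio_pos a3 hbc e3).le (Real.exp_pos _).le)
    have hstep : crossRatio (f a) (f b) (f c) (f e) ≤
        T ^ 2 * crossRatio (f a') (f b) (f c) (f e') := by
      have v1 := hf.mono a3
      have v2 := hf.mono e3
      have v3 := hf.mono hce
      have v4 := hf.mono hbc
      rw [crossRatio_eq, crossRatio_eq]
      calc _ ≤ (T * ((f b - f a') / (f c - f a'))) * (T * ((f e' - f c) / (f e' - f b))) :=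
            mul_le_mul l1 r1 (div_nonneg (by linarith) (by linarith))
              (mul_nonneg (by linarith) (div_nonneg (by linarith) (by linarith)))
        _ = _ := by ring
    calc _ ≤ T ^ 2 * (Real.exp δ * Real.exp I * crossRatio a b c e) :=
          hstep.trans (mul_le_mul_of_nonneg_left hloc' (by positivity))
      _ = T ^ 2 * Real.exp δ * (Real.exp I * crossRatio a b c e) := by ring
      _ ≤ A * (Real.exp I * crossRatio a b c e) := by
          refine mul_le_mul_of_nonneg_right ?_ (mul_nonneg (Real.exp_pos _).le hcr)
          have : 0 ≤ 9 * L ^ 2 / m ^ 2 := by positivity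
          linarith
      _ = _ := by ring

end Global

section Quadratic

variable {f : ℝ → ℝ} {c₀ d D : ℝ}

/-- The criticality of a critical point of a smooth map is at least `2`. -/
theorem IsNonFlatCritPt.two_le (hf : StrictMono f) (hs : ContDiff ℝ 3 f) (h0 : deriv f c₀ = 0)
    (h : IsNonFlatCritPt f c₀ d) : 2 ≤ d := by
  obtain ⟨φ, A, δ, hA, hδ, hφ0, hfφ, hbd, -⟩ := h.exists_coordinate hf
  have hd := h.1
  by_contra! hd2
  obtain ⟨K, hK⟩ := exists_taylor_mean_remainder_bound (f := f) (a := c₀) (b := c₀ + δ) (n := 1)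
    (by linarith) ((hs.of_le (by norm_num)).contDiffOn)
  have hder : derivWithin f (Icc c₀ (c₀ + δ)) c₀ = 0 := by
    rw [DifferentiableAt.derivWithin (hs.differentiable (by norm_num) c₀)
      (uniqueDiffOn_Icc (by linarith) c₀ ⟨le_rfl, by linarith⟩), h0]
  have hle : ∀ t ∈ Ioo 0 δ, (A / 2) ^ d ≤ K * t ^ (2 - d) := by
    intro t ht
    have h1 := hK (c₀ + t) ⟨by linarith [ht.1], by linarith [ht.2]⟩
    rw [taylorWithinEval_succ, taylor_within_zero_eval, iteratedDerivWithin_one, hder] at h1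
    simp only [add_sub_cancel_left, smul_zero, add_zero] at h1
    have h2 := hfφ (c₀ + t) ⟨by linarith [ht.1], by linarith [ht.2]⟩
    have h3 := (hbd c₀ (c₀ + t) (by linarith) (by linarith [ht.1]) (by linarith [ht.2])).1
    rw [hφ0, sub_zero, add_sub_cancel_left] at h3
    have hAt : 0 < A / 2 * t := mul_pos (by positivity) ht.1
    rw [oddPow_of_nonneg (by linarith) (by linarith)] at h2
    have h4 : (A / 2 * t) ^ d ≤ φ (c₀ + t) ^ d :=
      Real.rpow_le_rpow hAt.le h3 (by linarith)
    rw [Real.mul_rpow (by positivity) ht.1.le] at h4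
    rw [Real.norm_eq_abs, one_add_one_eq_two] at h1
    have h5 := le_abs_self (f (c₀ + t) - f c₀)
    have h6 : (A / 2) ^ d * t ^ d ≤ K * t ^ (2 : ℕ) := by linarith
    have h7 : t ^ (2 : ℕ) = t ^ (2 - d) * t ^ d := by
      rw [← Real.rpow_add ht.1, sub_add_cancel]; norm_num
    rw [h7, ← mul_assoc] at h6
    exact le_of_mul_le_mul_right h6 (Real.rpow_pos_of_pos ht.1 d)
  have hlim : Tendsto (fun t : ℝ => K * t ^ (2 - d)) (𝓝[>] 0) (𝓝 (K * 0)) := by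
    have : Tendsto (fun t : ℝ => t ^ (2 - d)) (𝓝 0) (𝓝 (0 ^ (2 - d))) :=
      (Real.continuousAt_rpow_const 0 (2 - d) (Or.inr (by linarith))).tendsto
    rw [Real.zero_rpow (by linarith)] at this
    exact (this.mono_left nhdsWithin_le_nhds).const_mul K
  have hge := ge_of_tendsto hlim (by
    filter_upwards [Ioo_mem_nhdsGT hδ] with t ht using hle t ht)
  have : 0 < (A / 2) ^ d := Real.rpow_pos_of_pos (by positivity) d
  linarith

theorem rpow_mul_sq_le {s t u v : ℝ} (hs : 0 < s) (hst : s ≤ t) (hu : 0 ≤ u) (hv : 0 ≤ v)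
    (huv : u * t ≤ 4 * s * v) (hd : 2 ≤ d) (hD : d ≤ D) :
    u ^ d * t ^ 2 ≤ 4 ^ D * s ^ 2 * v ^ d := by
  have ht : 0 < t := hs.trans_le hst
  have h1 : u ≤ 4 * (s / t) * v := by
    rw [show 4 * (s / t) * v = 4 * s * v / t by ring, le_div_iff₀ ht]; exact huv
  have h2 : u ^ d ≤ (4 * (s / t) * v) ^ d := Real.rpow_le_rpow hu h1 (by linarith)
  rw [Real.mul_rpow (by positivity) hv, Real.mul_rpow (by norm_num) (by positivity)] at h2
  have h3 : (s / t) ^ d ≤ (s / t) ^ 2 := by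
    rw [← Real.rpow_two]
    exact Real.rpow_le_rpow_of_exponent_ge (by positivity) ((div_le_one ht).2 hst) hd
  have h4 : (4 : ℝ) ^ d ≤ 4 ^ D := Real.rpow_le_rpow_of_exponent_le (by norm_num) hD
  calc u ^ d * t ^ 2 ≤ 4 ^ d * (s / t) ^ d * v ^ d * t ^ 2 := by gcongr
    _ ≤ 4 ^ D * (s / t) ^ 2 * v ^ d * t ^ 2 := by gcongr
    _ = _ := by field_simp

/-- On either side of a critical point, `f` grows at least quadratically. -/
theorem IsNonFlatCritPt.exists_quadratic (hf : StrictMono f) (h : IsNonFlatCritPt f c₀ d)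
    (hd : 2 ≤ d) (hD : d ≤ D) :
    ∃ δ > 0, ∀ s t, 0 < s → s ≤ t → t < δ →
      (f (c₀ + s) - f c₀) * t ^ 2 ≤ 4 ^ D * s ^ 2 * (f (c₀ + t) - f c₀) ∧
      (f c₀ - f (c₀ - s)) * t ^ 2 ≤ 4 ^ D * s ^ 2 * (f c₀ - f (c₀ - t)) := by
  obtain ⟨φ, A, δ, hA, hδ, h0, hfφ, hbd, -⟩ := h.exists_coordinate hf
  refine ⟨δ, hδ, fun s t hs hst ht => ?_⟩
  have ht0 : 0 < t := hs.trans_le hst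
  constructor
  · have h1 := hbd c₀ (c₀ + s) (by linarith) (by linarith) (by linarith)
    have h2 := hbd c₀ (c₀ + t) (by linarith) (by linarith) (by linarith)
    rw [h0, sub_zero, add_sub_cancel_left] at h1 h2
    have p1 : 0 < A / 2 * s := by positivity
    have p2 : 0 < A / 2 * t := by positivity
    rw [hfφ (c₀ + s) ⟨by linarith, by linarith⟩, hfφ (c₀ + t) ⟨by linarith, by linarith⟩,
      add_sub_cancel_left, add_sub_cancel_left, oddPow_of_nonneg (by linarith) (by linarith),
      oddPow_of_nonneg (by linarith) (by linarith)]
    refine rpow_mul_sq_le hs hst (by linarith) (by linarith) ?_ hd hD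
    calc _ ≤ 2 * A * s * t := by gcongr; exact h1.2
      _ = 4 * s * (A / 2 * t) := by ring
      _ ≤ _ := by gcongr; exact h2.1
  · have h1 := hbd (c₀ - s) c₀ (by linarith) (by linarith) (by linarith)
    have h2 := hbd (c₀ - t) c₀ (by linarith) (by linarith) (by linarith)
    rw [h0, zero_sub, sub_sub_cancel] at h1 h2
    have p1 : 0 < A / 2 * s := by positivity
    have p2 : 0 < A / 2 * t := by positivity
    have e : ∀ r, f c₀ - (f c₀ + oddPow d (φ r)) = oddPow d (-φ r) := fun r => by
      rw [oddPow_neg]; ring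
    rw [hfφ (c₀ - s) ⟨by linarith, by linarith⟩, hfφ (c₀ - t) ⟨by linarith, by linarith⟩,
      e, e, oddPow_of_nonneg (by linarith) (by linarith),
      oddPow_of_nonneg (by linarith) (by linarith)]
    refine rpow_mul_sq_le hs hst (by linarith) (by linarith) ?_ hd hD
    calc _ ≤ 2 * A * s * t := by gcongr; exact h1.2
      _ = 4 * s * (A / 2 * t) := by ring
      _ ≤ _ := by gcongr; exact h2.1

end Quadratic

section Returns

variable {f : ℝ → ℝ} {C : Finset ℝ} {ρ κ δ Λ K : ℝ}

theorem WindowCrossRatioBound.mono {q q' : ℕ} {p : ℤ} {B B' : ℝ}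
    (h : WindowCrossRatioBound f q p q' B) (hB : B ≤ B') : WindowCrossRatioBound f q p q' B' :=
  fun x a b c e hxa hab hbc hce he k hk => (h x a b c e hxa hab hbc hce he k hk).trans
    (mul_le_mul_of_nonneg_right hB (crossRatio_pos hab hbc hce).le)

theorem reflect_reflect (f : ℝ → ℝ) : reflect (reflect f) = f := by
  funext x
  simp [reflect]

theorem abs_retMap_reflect_sub (q : ℕ) (p : ℤ) (x : ℝ) :
    |retMap (reflect f) q (-p) (-x) - -x| = |retMap f q p x - x| := by
  rw [retMap_reflect, neg_neg, neg_sub_neg, abs_sub_comm]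

protected theorem GapsComparable.reflect {q : ℕ} {p : ℤ} (h : GapsComparable f q p K) :
    GapsComparable (reflect f) q (-p) K :=
  GapsComparable.of_reflect (by rwa [reflect_reflect, neg_neg])

theorem abs_retMap_iterate_three_sub_le {q : ℕ} {p : ℤ} {ε : ℝ}
    (h : ∀ x, |retMap f q p x - x| ≤ ε) (x : ℝ) :
    |retMap f q p (retMap f q p (retMap f q p x)) - x| ≤ 3 * ε := by
  have h1 := abs_le.1 (h x)
  have h2 := abs_le.1 (h (retMap f q p x))
  have h3 := abs_le.1 (h (retMap f q p (retMap f q p x)))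
  rw [abs_le]
  constructor <;> linarith

theorem IrrationalLift.abs_retMap_sub_le_one (hf : IrrationalLift f ρ) (hρ : ρ ∈ Ioo (0 : ℝ) 1)
    (n : ℕ) (x : ℝ) : |retMap f (qden ρ n) (pnum ρ n : ℤ) x - x| ≤ 1 := by
  rcases Nat.even_or_odd n with hn | hn
  · have hL := isLevel_of_even hf.irr hρ hn
    have h1 := hf.lt_retMap hL.pos x
    have h2 := hf.retMap_le_add_one hL.le_one x
    rw [abs_le]
    constructor <;> linarith
  · have hL := isLevel_of_odd hf.irr hρ hn
    have h1 := hf.reflect.lt_retMap hL.pos (-x)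
    have h2 := hf.reflect.retMap_le_add_one hL.le_one (-x)
    rw [← abs_retMap_reflect_sub, abs_le]
    constructor <;> linarith

/-- The distortion constant of cross-ratios in the windows of a given level, in terms of a local
cross-ratio bound and of the number of critical points. -/
def windowConst (κ Λ : ℝ) (N : ℕ) : ℝ := Real.exp (9 * (2 * κ + N * Λ))

theorem one_le_windowConst (hκ : 0 ≤ κ) (hΛ : 0 ≤ Λ) (N : ℕ) : 1 ≤ windowConst κ Λ N :=
  Real.one_le_exp (by positivity)

theorem windowConst_mono (hΛ : 0 ≤ Λ) {M N : ℕ} (h : M ≤ N) :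
    windowConst κ Λ M ≤ windowConst κ Λ N := by
  have : (M : ℝ) ≤ N := by exact_mod_cast h
  unfold windowConst
  gcongr

theorem LocalCrossRatioBound.window_of_even (hf : IrrationalLift f ρ) (hρ : ρ ∈ Ioo (0 : ℝ) 1)
    (hκ : 0 ≤ κ) (hΛ : 0 ≤ Λ) (hC : LocalCrossRatioBound f C κ δ Λ) {n N : ℕ} (hN : C.card ≤ N)
    (hn : Even n) {ε : ℝ} (hε : 3 * ε ≤ δ)
    (h : ∀ x, |retMap f (qden ρ n) (pnum ρ n : ℤ) x - x| ≤ ε) :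
    WindowCrossRatioBound f (qden ρ n) (pnum ρ n : ℤ) (qden ρ (n + 1)) (windowConst κ Λ N) :=
  (hC.window hf (isLevel_of_even hf.irr hρ hn) hκ hΛ fun x =>
    (le_abs_self _).trans ((abs_retMap_iterate_three_sub_le h x).trans hε)).mono
      (windowConst_mono hΛ hN)

theorem LocalCrossRatioBound.window_of_odd (hf : IrrationalLift f ρ) (hρ : ρ ∈ Ioo (0 : ℝ) 1)
    (hκ : 0 ≤ κ) (hΛ : 0 ≤ Λ) (hC : LocalCrossRatioBound f C κ δ Λ) {n N : ℕ} (hN : C.card ≤ N)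
    (hn : Odd n) {ε : ℝ} (hε : 3 * ε ≤ δ)
    (h : ∀ x, |retMap f (qden ρ n) (pnum ρ n : ℤ) x - x| ≤ ε) :
    WindowCrossRatioBound (reflect f) (qden ρ n) (-(pnum ρ n : ℤ)) (qden ρ (n + 1))
      (windowConst κ Λ N) := by
  refine (hC.reflect.window hf.reflect (isLevel_of_odd hf.irr hρ hn) hκ hΛ fun x =>
    (le_abs_self _).trans ((abs_retMap_iterate_three_sub_le (ε := ε) (fun y => ?_) x).trans
      hε)).mono (windowConst_mono hΛ ?_)
  · have := h (-y)
    rwa [← abs_retMap_reflect_sub, neg_neg] at this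
  · rwa [Finset.card_image_of_injective _ neg_injective]

theorem LocalCrossRatioBound.gapsComparable (hf : IrrationalLift f ρ) (hρ : ρ ∈ Ioo (0 : ℝ) 1)
    (hκ : 0 ≤ κ) (hΛ : 0 ≤ Λ) (hC : LocalCrossRatioBound f C κ δ Λ) {n N : ℕ} (hN : C.card ≤ N)
    {ε : ℝ} (hε : 3 * ε ≤ δ) (h : ∀ x, |retMap f (qden ρ n) (pnum ρ n : ℤ) x - x| ≤ ε) :
    GapsComparable f (qden ρ n) (pnum ρ n : ℤ) (gapConst (windowConst κ Λ N)) := by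
  have h1 := one_le_windowConst hκ hΛ N
  rcases Nat.even_or_odd n with hn | hn
  · exact (hC.window_of_even hf hρ hκ hΛ hN hn hε h).gapsComparable hf
      (isLevel_of_even hf.irr hρ hn) h1
  · exact ((hC.window_of_odd hf hρ hκ hΛ hN hn hε h).gapsComparable hf.reflect
      (isLevel_of_odd hf.irr hρ hn) h1).of_reflect

theorem IrrationalLift.gap_shrink (hf : IrrationalLift f ρ) (hρ : ρ ∈ Ioo (0 : ℝ) 1) (hK : 0 ≤ K)
    (hg : ∀ n, GapsComparable f (qden ρ n) (pnum ρ n : ℤ) K) (n : ℕ) (x : ℝ) :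
    (K + 1) * |retMap f (qden ρ (n + 2)) (pnum ρ (n + 2) : ℤ) x - x| ≤
      K * |retMap f (qden ρ n) (pnum ρ n : ℤ) x - x| := by
  have e1 := convergent_error_recurrence hf.irr hρ n
  have e2 := convergent_error_lt hf.irr hρ (n + 1)
  rcases Nat.even_or_odd n with hn | hn
  · have hL := isLevel_of_even hf.irr hρ hn
    have hL2 := isLevel_of_even hf.irr hρ (hn.add even_two)
    rw [hn.neg_one_pow, hn.add_one.neg_one_pow, (hn.add even_two).neg_one_pow] at e1
    rw [hn.add_one.neg_one_pow, show n + 1 + 1 = n + 2 from rfl,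
      (hn.add even_two).neg_one_pow] at e2
    rw [abs_of_pos (sub_pos.2 (hf.lt_retMap hL.pos x)),
      abs_of_pos (sub_pos.2 (hf.lt_retMap hL2.pos x))]
    exact (hg (n + 1)).shrink hf hK hL.neg (by push_cast; linarith) (by push_cast; linarith) x
  · have hL := isLevel_of_odd hf.irr hρ hn
    have hL2 := isLevel_of_odd hf.irr hρ (hn.add_even even_two)
    rw [hn.neg_one_pow, hn.add_one.neg_one_pow, (hn.add_even even_two).neg_one_pow] at e1
    rw [hn.add_one.neg_one_pow, show n + 1 + 1 = n + 2 from rfl,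
      (hn.add_even even_two).neg_one_pow] at e2
    rw [← abs_retMap_reflect_sub, ← abs_retMap_reflect_sub (p := (pnum ρ n : ℤ)),
      abs_of_pos (sub_pos.2 (hf.reflect.lt_retMap hL.pos _)),
      abs_of_pos (sub_pos.2 (hf.reflect.lt_retMap hL2.pos _))]
    exact (hg (n + 1)).reflect.shrink hf.reflect hK hL.neg (by push_cast; linarith)
      (by push_cast; linarith) (-x)

theorem IrrationalLift.exists_gap_le (hf : IrrationalLift f ρ) (hρ : ρ ∈ Ioo (0 : ℝ) 1)
    (hK : 0 ≤ K) (hg : ∀ n, GapsComparable f (qden ρ n) (pnum ρ n : ℤ) K) {ε : ℝ} (hε : 0 < ε) :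
    ∃ n₀ : ℕ, ∀ n ≥ n₀, ∀ x, |retMap f (qden ρ n) (pnum ρ n : ℤ) x - x| ≤ ε := by
  have hθ : K / (K + 1) < 1 := (div_lt_one (by linarith)).2 (by linarith)
  have hθ0 : 0 ≤ K / (K + 1) := by positivity
  have hpow : ∀ m j x, |retMap f (qden ρ (2 * m + j)) (pnum ρ (2 * m + j) : ℤ) x - x| ≤
      (K / (K + 1)) ^ m := by
    intro m j x
    induction m with
    | zero => simpa using hf.abs_retMap_sub_le_one hρ j x
    | succ m ih =>
      have := hf.gap_shrink hρ hK hg (2 * m + j) x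
      rw [show 2 * (m + 1) + j = 2 * m + j + 2 by ring, pow_succ']
      calc _ ≤ K / (K + 1) * |retMap f (qden ρ (2 * m + j)) (pnum ρ (2 * m + j) : ℤ) x - x| := by
            rw [div_mul_eq_mul_div, le_div_iff₀ (by linarith)]; linarith
        _ ≤ _ := by gcongr
  obtain ⟨m, hm⟩ := exists_pow_lt_of_lt_one hε hθ
  refine ⟨2 * m, fun n hn x => ?_⟩
  obtain ⟨j, rfl⟩ := Nat.exists_eq_add_of_le hn
  exact (hpow m j x).trans hm.le

/-- The displacements at `x` of two return maps are comparable. -/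
def ReturnsComparable (f : ℝ → ℝ) (q : ℕ) (p : ℤ) (q' : ℕ) (p' : ℤ) (M x : ℝ) : Prop :=
  |retMap f q p x - x| ≤ M * |retMap f q' p' x - x| ∧
    |retMap f q' p' x - x| ≤ M * |retMap f q p x - x|

/-- The comparability constant for two consecutive returns along a critical orbit. -/
def returnConst (B Q K : ℝ) : ℝ := orbitConst B (critConst B Q K) K + K

theorem critConst_nonneg {B Q : ℝ} (hB : 0 ≤ B) (hQ : 0 ≤ Q) (hK : 0 ≤ K) :
    0 ≤ critConst B Q K := by
  unfold critConst; positivity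

theorem le_returnConst {B Q : ℝ} (hB : 0 ≤ B) : K ≤ returnConst B Q K := by
  have : 0 ≤ orbitConst B (critConst B Q K) K := by unfold orbitConst; positivity
  unfold returnConst; linarith

theorem WindowCrossRatioBound.returnsComparable {q q' : ℕ} {p p' : ℤ} (hf : IrrationalLift f ρ)
    (hL : IsLevel ρ q p q' p') {B Q c : ℝ} (hB : 1 ≤ B) (hQ : 0 ≤ Q) (hK : 0 ≤ K)
    (hw : WindowCrossRatioBound f q p q' B)
    (hg : GapsComparable f q p K) (hh : GapsComparable f q' p' K)
    (hc : ∀ s t, 0 < s → s ≤ t → t ≤ |retMap f q p c - c| →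
      (f (c + s) - f c) * t ^ 2 ≤ Q * s ^ 2 * (f (c + t) - f c)) {k : ℕ} (hk : k ≤ q + q') :
    ReturnsComparable f q p q' p' (returnConst B Q K) (f^[k] c) := by
  have hM := critConst_nonneg (B := B) (Q := Q) (K := K) (by linarith) hQ hK
  have hO : 0 ≤ orbitConst B (critConst B Q K) K := by unfold orbitConst; positivity
  have h1 := hw.forward_le_at_critical hf hL (by linarith) hQ hK hg hh (c := c) fun u hu hug => by
    have := hc (u - c) (retMap f q p c - c) (by linarith) (by linarith) (le_abs_self _)
    simpa only [add_sub_cancel] using this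
  have h2 := hw.forward_le hf hL (by linarith) hM hK hg hh h1 hk
  have h3 := hL.backward_le hf hg (f^[k] c)
  have p1 := sub_pos.2 (hf.lt_retMap hL.pos (f^[k] c))
  have p2 := sub_neg.2 (hf.retMap_lt hL.neg (f^[k] c))
  rw [ReturnsComparable, abs_of_pos p1, abs_of_neg p2, neg_sub, returnConst]
  have n1 := mul_nonneg hK (show 0 ≤ f^[k] c - retMap f q' p' (f^[k] c) by linarith)
  have n2 := mul_nonneg hO p1.le
  constructor <;> linarith

theorem ReturnsComparable.of_reflect {q q' : ℕ} {p p' : ℤ} {M x : ℝ}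
    (h : ReturnsComparable (reflect f) q (-p) q' (-p') M (-x)) :
    ReturnsComparable f q p q' p' M x := by
  simpa only [ReturnsComparable, abs_retMap_reflect_sub] using h

end Returns

section Atoms

variable {f : ℝ → ℝ} {C : Finset ℝ} {ρ κ δ Λ c : ℝ} {n : ℕ}

theorem LocalCrossRatioBound.returnsComparable (hf : IrrationalLift f ρ) (hρ : ρ ∈ Ioo (0 : ℝ) 1)
    (hκ : 0 ≤ κ) (hΛ : 0 ≤ Λ) (hC : LocalCrossRatioBound f C κ δ Λ) {N : ℕ} (hN : C.card ≤ N)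
    {ε Q : ℝ} (hQ : 0 ≤ Q) (hε : 3 * ε ≤ δ)
    (h : ∀ x, |retMap f (qden ρ n) (pnum ρ n : ℤ) x - x| ≤ ε)
    (h' : ∀ x, |retMap f (qden ρ (n + 1)) (pnum ρ (n + 1) : ℤ) x - x| ≤ ε)
    (hc : ∀ s t, 0 < s → s ≤ t → t ≤ ε →
      (f (c + s) - f c) * t ^ 2 ≤ Q * s ^ 2 * (f (c + t) - f c) ∧
      (f c - f (c - s)) * t ^ 2 ≤ Q * s ^ 2 * (f c - f (c - t)))
    {k : ℕ} (hk : k ≤ qden ρ n + qden ρ (n + 1)) :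
    ReturnsComparable f (qden ρ n) (pnum ρ n : ℤ) (qden ρ (n + 1)) (pnum ρ (n + 1) : ℤ)
      (returnConst (windowConst κ Λ N) Q (gapConst (windowConst κ Λ N))) (f^[k] c) := by
  have hB := one_le_windowConst hκ hΛ N
  have hK := zero_le_one.trans (one_le_gapConst hB)
  have hg := hC.gapsComparable hf hρ hκ hΛ hN hε h
  have hh := hC.gapsComparable hf hρ hκ hΛ hN hε h'
  rcases Nat.even_or_odd n with hn | hn
  · exact (hC.window_of_even hf hρ hκ hΛ hN hn hε h).returnsComparable hf
      (isLevel_of_even hf.irr hρ hn) hB hQ hK hg hh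
      (fun s t hs hst ht => (hc s t hs hst (ht.trans (h c))).1) hk
  · refine ReturnsComparable.of_reflect ?_
    have := (hC.window_of_odd hf hρ hκ hΛ hN hn hε h).returnsComparable hf.reflect
      (isLevel_of_odd hf.irr hρ hn) hB hQ hK hg.reflect hh.reflect (c := -c)
      (fun s t hs hst ht => ?_) hk
    · rwa [reflect_iterate, neg_neg] at this
    · rw [abs_retMap_reflect_sub] at ht
      have := (hc s t hs hst (ht.trans (h c))).2
      simp only [reflect, neg_add, neg_neg, ← sub_eq_add_neg]
      linarith

theorem retPt_eq_retMap (f : ℝ → ℝ) (ρ x : ℝ) (n : ℕ) :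
    retPt f ρ x n = retMap f (qden ρ n) (pnum ρ n : ℤ) x := by
  simp [retPt, retMap]

theorem IrrationalLift.eq_of_sameCirclePt (hf : IrrationalLift f ρ) {a b : ℕ}
    (h : SameCirclePt (f^[a] c) (f^[b] c)) : a = b := by
  obtain ⟨m, hm⟩ := h
  by_contra hab
  have hne : (a : ℝ) * ρ - (0 : ℤ) ≠ b * ρ - (-m : ℤ) := by
    intro he
    have hd : ((a : ℤ) - b : ℤ) ≠ 0 := by omega
    refine (hf.irr.intCast_mul hd).ne_int m ?_
    push_cast at he ⊢
    linarith
  rcases hne.lt_or_gt with hlt | hlt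
  all_goals
    have := hf.retMap_lt_retMap hlt c
    simp only [retMap] at this
    push_cast at this
    linarith

theorem IrrationalLift.sameCirclePt_iterate_retMap (hf : IrrationalLift f ρ) (i q : ℕ) (p : ℤ) :
    SameCirclePt (f^[i] (retMap f q p c)) (f^[i + q] c) :=
  ⟨-p, by rw [retMap, hf.iterate_sub_int, ← Function.iterate_add_apply]; push_cast; ring⟩

theorem SameCirclePt.symm {a b : ℝ} (h : SameCirclePt a b) : SameCirclePt b a := by
  obtain ⟨m, hm⟩ := h
  exact ⟨-m, by push_cast; linarith⟩

theorem SameCirclePt.trans {a b e : ℝ} (h : SameCirclePt a b) (h' : SameCirclePt b e) :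
    SameCirclePt a e := by
  obtain ⟨m, hm⟩ := h
  obtain ⟨k, hk⟩ := h'
  exact ⟨k + m, by push_cast; linarith⟩

theorem IrrationalLift.abs_retMap_sub_congr (hf : IrrationalLift f ρ) {a b : ℝ}
    (h : SameCirclePt a b) (q : ℕ) (p : ℤ) : |retMap f q p a - a| = |retMap f q p b - b| := by
  obtain ⟨m, rfl⟩ := h
  rw [hf.retMap_add_int, add_sub_add_right_eq_sub]

theorem GapsComparable.iterate {K : ℝ} {q : ℕ} {p : ℤ} (hf : IrrationalLift f ρ)
    (h : GapsComparable f q p K) (i : ℕ) :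
    |retMap f q p (f^[i + q] c) - f^[i + q] c| ≤ K * |retMap f q p (f^[i] c) - f^[i] c| ∧
      |retMap f q p (f^[i] c) - f^[i] c| ≤ K * |retMap f q p (f^[i + q] c) - f^[i + q] c| := by
  have := h (f^[i] c)
  have e := hf.abs_retMap_sub_congr (hf.sameCirclePt_iterate_retMap (c := c) i q p) q p
  rw [hf.iterate_retMap] at e
  rwa [e] at this

/-- The level of the return map whose fundamental domains contain the given atom. -/
def atomLevel (n : ℕ) : AtomIdx ρ n → ℕ
  | Sum.inl _ => n
  | Sum.inr _ => n + 1

/-- The iterate of the base arc which is the given atom. -/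
def atomTime : AtomIdx ρ n → ℕ
  | Sum.inl i => i.1
  | Sum.inr j => j.1

theorem IrrationalLift.atomLen_eq (hf : IrrationalLift f ρ) (A : AtomIdx ρ n) :
    atomLen f ρ c n A = |retMap f (qden ρ (atomLevel n A)) (pnum ρ (atomLevel n A) : ℤ)
      (f^[atomTime A] c) - f^[atomTime A] c| := by
  rcases A with i | j <;>
  simp only [atomLen, atomL, atomR, atomLevel, atomTime, retPt_eq_retMap, hf.iterate_retMap,
    max_sub_min_eq_abs]

theorem IrrationalLift.sameCirclePt_endpoint (hf : IrrationalLift f ρ) (A : AtomIdx ρ n) {p : ℝ}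
    (hp : p ∈ ({atomL f ρ c n A, atomR f ρ c n A} : Set ℝ)) :
    ∃ k, (k = atomTime A ∨ k = atomTime A + qden ρ (atomLevel n A)) ∧
      SameCirclePt p (f^[k] c) := by
  have key : ∀ (i m : ℕ), p = f^[i] c ∨ p = f^[i] (retPt f ρ c m) →
      ∃ k, (k = i ∨ k = i + qden ρ m) ∧ SameCirclePt p (f^[k] c) := by
    rintro i m (rfl | rfl)
    · exact ⟨i, Or.inl rfl, 0, by simp⟩
    · exact ⟨_, Or.inr rfl, retPt_eq_retMap f ρ c m ▸ hf.sameCirclePt_iterate_retMap _ _ _⟩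
  rcases A with i | j
  · refine key i.1 n ?_
    rcases hp with rfl | rfl
    · exact min_choice _ _
    · exact max_choice _ _
  · refine key j.1 (n + 1) ?_
    rcases hp with rfl | rfl
    · exact min_choice _ _
    · exact max_choice _ _

theorem AdjacentAtoms.symm {A B : AtomIdx ρ n} (h : AdjacentAtoms f ρ c n A B) :
    AdjacentAtoms f ρ c n B A := by
  obtain ⟨hne, p, hp, q, hq, hpq⟩ := h
  exact ⟨hne.symm, q, hq, p, hp, hpq.symm⟩

theorem IrrationalLift.exists_common_time (hf : IrrationalLift f ρ) {A B : AtomIdx ρ n}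
    (h : AdjacentAtoms f ρ c n A B) :
    ∃ k, (k = atomTime A ∨ k = atomTime A + qden ρ (atomLevel n A)) ∧
      (k = atomTime B ∨ k = atomTime B + qden ρ (atomLevel n B)) := by
  obtain ⟨-, p, hp, q, hq, hpq⟩ := h
  obtain ⟨k, hk, hpk⟩ := hf.sameCirclePt_endpoint A hp
  obtain ⟨l, hl, hql⟩ := hf.sameCirclePt_endpoint B hq
  obtain rfl := hf.eq_of_sameCirclePt (hpk.symm.trans (hpq.trans hql))
  exact ⟨k, hk, hl⟩

theorem atomTime_add_le (A : AtomIdx ρ n) :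
    atomTime A + qden ρ (atomLevel n A) ≤ qden ρ n + qden ρ (n + 1) := by
  rcases A with ⟨i, hi⟩ | ⟨j, hj⟩ <;> simp only [atomTime, atomLevel] <;> omega

/-- Adjacent atoms are comparable when the return maps of the two levels have comparable
fundamental domains and comparable displacements along the orbit of the base point. -/
theorem IrrationalLift.atomLen_le (hf : IrrationalLift f ρ) {K M : ℝ} (hK : 1 ≤ K) (hKM : K ≤ M)
    (hg : GapsComparable f (qden ρ n) (pnum ρ n : ℤ) K)
    (hh : GapsComparable f (qden ρ (n + 1)) (pnum ρ (n + 1) : ℤ) K)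
    (hr : ∀ k ≤ qden ρ n + qden ρ (n + 1), ReturnsComparable f (qden ρ n) (pnum ρ n : ℤ)
      (qden ρ (n + 1)) (pnum ρ (n + 1) : ℤ) M (f^[k] c))
    {A B : AtomIdx ρ n} (hAB : AdjacentAtoms f ρ c n A B) :
    atomLen f ρ c n A ≤ M ^ 3 * atomLen f ρ c n B := by
  obtain ⟨k, hkA, hkB⟩ := hf.exists_common_time hAB
  set G : ℕ → ℝ := fun m =>
    |retMap f (qden ρ m) (pnum ρ m : ℤ) (f^[k] c) - f^[k] c| with hG
  have hM1 : 1 ≤ M := hK.trans hKM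
  have hgaps : ∀ E : AtomIdx ρ n, GapsComparable f (qden ρ (atomLevel n E))
      (pnum ρ (atomLevel n E) : ℤ) M := by
    rintro (i | j)
    · exact hg.mono hKM
    · exact hh.mono hKM
  have hle : ∀ E : AtomIdx ρ n,
      (k = atomTime E ∨ k = atomTime E + qden ρ (atomLevel n E)) →
      atomLen f ρ c n E ≤ M * G (atomLevel n E) ∧ G (atomLevel n E) ≤ M * atomLen f ρ c n E := by
    intro E hE
    rw [hf.atomLen_eq]
    rcases hE with hE | hE
    · rw [← hE]
      exact ⟨le_mul_of_one_le_left (abs_nonneg _) hM1, le_mul_of_one_le_left (abs_nonneg _) hM1⟩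
    · have := (hgaps E).iterate hf (atomTime E) (c := c)
      rw [← hE] at this
      exact ⟨this.2, this.1⟩
  have hkle : k ≤ qden ρ n + qden ρ (n + 1) := by
    have := atomTime_add_le A
    omega
  have hlev : G (atomLevel n A) ≤ M * G (atomLevel n B) := by
    have h1 := hr k hkle
    rcases A with i | i <;> rcases B with j | j
    · exact le_mul_of_one_le_left (abs_nonneg _) hM1
    · exact h1.1
    · exact h1.2
    · exact le_mul_of_one_le_left (abs_nonneg _) hM1
  calc _ ≤ M * G (atomLevel n A) := (hle A hkA).1
    _ ≤ M * (M * G (atomLevel n B)) := by gcongr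
    _ ≤ M * (M * (M * atomLen f ρ c n B)) := by gcongr; exact (hle B hkB).2
    _ = _ := by ring

end Atoms

end MCircle

open MCircle

/-- **Beau bounds** (Theorem A). Given `N ≥ 1` and `d > 1` there is `B = B(N,d) > 1`
such that for every multicritical circle map `f` with irrational rotation number,
having at most `N` critical points with criticalities at most `d`, there is
`n₀ = n₀(f)` such that for all `n ≥ n₀` any two adjacent atoms `I, J` of the `n`-th
dynamical partition `𝒫ₙ` (associated to a fixed critical point `c₀`) satisfy
`|J|/B ≤ |I| ≤ B|J|`. -/
theorem beau_bounds (N : ℕ) (hN : 1 ≤ N) (d : ℝ) (hd : 1 < d) :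
    ∃ B : ℝ, 1 < B ∧
      ∀ (f : ℝ → ℝ) (C : Finset ℝ) (dc : ℝ → ℝ) (ρ c₀ : ℝ),
        GoodMap f C dc ρ → C.card ≤ N → (∀ c ∈ C, dc c ≤ d) → c₀ ∈ C →
        ∃ n₀ : ℕ, ∀ n ≥ n₀, ∀ I J : AtomIdx ρ n, AdjacentAtoms f ρ c₀ n I J →
          atomLen f ρ c₀ n J / B ≤ atomLen f ρ c₀ n I ∧
          atomLen f ρ c₀ n I ≤ B * atomLen f ρ c₀ n J := by
  have hΛ : 0 ≤ Real.log (4 * d ^ 2) := Real.log_nonneg (by nlinarith)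
  set B₀ := windowConst 1 (Real.log (4 * d ^ 2)) N with hB₀
  have hB₀1 : 1 ≤ B₀ := one_le_windowConst zero_le_one hΛ N
  have hK1 : 1 ≤ gapConst B₀ := one_le_gapConst hB₀1
  set M := returnConst B₀ (4 ^ d) (gapConst B₀) with hM
  have hKM : gapConst B₀ ≤ M := le_returnConst (by linarith)
  have hM0 : 0 < M ^ 3 := pow_pos (by linarith) 3
  refine ⟨M ^ 3 + 1, by linarith, fun f C dc ρ c₀ ⟨hm, hrot, hirr, hρ⟩ hCN hdc hc₀ => ?_⟩
  have hf := IrrationalLift.of_hasRotNumber hm.1 hrot hirr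
  obtain ⟨δ, hδ, hC⟩ := hm.exists_localCrossRatioBound hdc hd.le
  obtain ⟨κ, hκ, hC3⟩ := hC.exists_extend hm.1 hδ hΛ
  have hg : ∀ n, GapsComparable f (qden ρ n) (pnum ρ n : ℤ)
      (gapConst (windowConst κ (Real.log (4 * d ^ 2)) N)) := fun n =>
    hC3.gapsComparable hf hρ hκ hΛ hCN (by norm_num) (hf.abs_retMap_sub_le_one hρ n)
  have hflat := hm.2.2.2.2 c₀ hc₀
  have hd2 := hflat.two_le hm.1.mono hm.1.smooth
    ((hm.2.2.2.1 c₀).2 ⟨c₀, hc₀, 0, by simp⟩)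
  obtain ⟨r, hr, hquad⟩ := hflat.exists_quadratic hm.1.mono hd2 (hdc c₀ hc₀)
  obtain ⟨n₀, hn₀⟩ := hf.exists_gap_le hρ
    (zero_le_one.trans (one_le_gapConst (one_le_windowConst hκ hΛ N))) hg
    (show 0 < min (δ / 3) (r / 2) by positivity)
  have m1 := min_le_left (δ / 3) (r / 2)
  have m2 := min_le_right (δ / 3) (r / 2)
  refine ⟨n₀, fun n hn => ?_⟩
  have hle : ∀ I J : AtomIdx ρ n, AdjacentAtoms f ρ c₀ n I J →
      atomLen f ρ c₀ n I ≤ (M ^ 3 + 1) * atomLen f ρ c₀ n J := fun I J hIJ => by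
    have h0 : 0 ≤ atomLen f ρ c₀ n J := by rw [hf.atomLen_eq]; exact abs_nonneg _
    have := hf.atomLen_le hK1 hKM
      (hC.gapsComparable hf hρ zero_le_one hΛ hCN (by linarith) (hn₀ n hn))
      (hC.gapsComparable hf hρ zero_le_one hΛ hCN (by linarith) (hn₀ (n + 1) (by omega)))
      (fun k hk => hC.returnsComparable hf hρ zero_le_one hΛ hCN (by positivity) (by linarith)
        (hn₀ n hn) (hn₀ (n + 1) (by omega))
        (fun s t hs hst ht => hquad s t hs hst (by linarith)) hk) hIJ
    linarith
  intro I J hIJ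
  refine ⟨?_, hle I J hIJ⟩
  rw [div_le_iff₀ (by linarith), mul_comm]
  exact hle J I hIJ.symm
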